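/- (Rigidity, Theorem 6.8.) Assume W is continuous and satisfies (H1), (H2), (H3), and that the wells are A = −B with columns (0, 0, A₃) for some A₃ ∈ ℝ³∖{0} (so A' = B' = 0). Let ω ⊂ ℝ² be a nonempty bounded convex open set, Ω := ω × I. Let h_n → 0⁺ and ε_n → 0⁺ be arbitrary sequences with sup_n ε_n/h_n^p < ∞, and let u_n : Ω → ℝ³ be C² maps with sup_n F^{h_n}_{ε_n}(u_n, Ω) < ∞. Then there exist a subsequence (not relabeled) and ξ₀ ∈ {A, B} such that ∫_Ω |∇_{h_n}u_n − ξ₀|^p dx → 0. -/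

import Mathlib

open MeasureTheory Filter Topology ENNReal NNReal Set

noncomputable section

/-- Vectors in ℝ³. -/
abbrev V3 := Fin 3 → ℝ

/-- 3×3 matrices, represented as the triple of their columns. -/
abbrev M33 := Fin 3 → V3

/-- Euclidean norm on ℝ³. -/
def vnorm (v : V3) : ℝ := Real.sqrt (∑ i, (v i) ^ 2)

/-- Frobenius (Euclidean) norm on 3×3 matrices. -/
def mnorm (ξ : M33) : ℝ := Real.sqrt (∑ j, ∑ i, (ξ j i) ^ 2)

/-- dist(ξ,{A,B}). -/
def mdist (A B ξ : M33) : ℝ := min (mnorm (ξ - A)) (mnorm (ξ - B))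

/-- Spatial points of ℝ³ = ℝ × ℝ × ℝ. -/
abbrev Pt := ℝ × ℝ × ℝ

/-- Directional partial derivative of a map `u : ℝ³ → ℝ³`. -/
def pd (e : Pt) (u : Pt → V3) (x : Pt) : V3 := fderiv ℝ u x e

def e1 : Pt := (1, 0, 0)
def e2 : Pt := (0, 1, 0)
def e3 : Pt := (0, 0, 1)

/-- Rescaled gradient ∇_h u = (∂₁u, ∂₂u, h⁻¹ ∂₃u), as a 3×3 matrix of columns. -/
def gradh (h : ℝ) (u : Pt → V3) (x : Pt) : M33 :=
  ![pd e1 u x, pd e2 u x, h⁻¹ • pd e3 u x]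

/-- Squared rescaled Hessian |∇²_h u|². -/
def hessh (h : ℝ) (u : Pt → V3) (x : Pt) : ℝ :=
  (vnorm (pd e1 (pd e1 u) x)) ^ 2 + (vnorm (pd e2 (pd e2 u) x)) ^ 2
    + (h⁻¹) ^ 4 * (vnorm (pd e3 (pd e3 u) x)) ^ 2
    + 2 * (vnorm (pd e2 (pd e1 u) x)) ^ 2
    + 2 * (h⁻¹) ^ 2 * (vnorm (pd e3 (pd e1 u) x)) ^ 2
    + 2 * (h⁻¹) ^ 2 * (vnorm (pd e3 (pd e2 u) x)) ^ 2

/-- The energy F^h_ε(u, S) = ∫_S (1/ε) W(∇_h u) + ε |∇²_h u|², valued in [0,∞]. -/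
def F (W : M33 → ℝ) (h ε : ℝ) (u : Pt → V3) (S : Set Pt) : ℝ≥0∞ :=
  ∫⁻ x in S, ENNReal.ofReal (ε⁻¹ * W (gradh h u x) + ε * hessh h u x)

/-- Hypothesis (H1): W ≥ 0, {W = 0} = {A, B}, A ≠ B, and A' − B' = 2 a ⊗ ν̄ for
some a ∈ ℝ³ and a unit vector ν̄ ∈ ℝ². -/
def H1 (W : M33 → ℝ) (A B : M33) : Prop :=
  (∀ ξ, 0 ≤ W ξ) ∧ (∀ ξ, W ξ = 0 ↔ ξ = A ∨ ξ = B) ∧ A ≠ B ∧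
    ∃ (a : V3) (ν : ℝ × ℝ), ν.1 ^ 2 + ν.2 ^ 2 = 1 ∧
      A 0 - B 0 = (2 * ν.1) • a ∧ A 1 - B 1 = (2 * ν.2) • a

/-- Hypothesis (H2): p-growth from above and below. -/
def H2 (W : M33 → ℝ) (p : ℝ) : Prop :=
  ∃ C > (0 : ℝ), ∀ ξ, C⁻¹ * (mnorm ξ) ^ p - C ≤ W ξ ∧ W ξ ≤ C * (mnorm ξ) ^ p + C

/-- Hypothesis (H3): non-degeneracy near the wells. -/
def H3 (W : M33 → ℝ) (A B : M33) (p : ℝ) : Prop :=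
  ∃ ϱ > (0 : ℝ), ∃ C > (0 : ℝ), ∀ ξ, mdist A B ξ ≤ ϱ →
    C⁻¹ * (mdist A B ξ) ^ p ≤ W ξ ∧ W ξ ≤ C * (mdist A B ξ) ^ p

/-- Hypothesis (H4): W(ξ₁, 0, ξ₃) ≤ W(ξ). -/
def H4 (W : M33 → ℝ) : Prop := ∀ ξ : M33, W ![ξ 0, 0, ξ 2] ≤ W ξ

/-- Normalization of the wells: A = −B, first column of A is a, second column is 0. -/
def Wells (A B : M33) (a : V3) : Prop := A = -B ∧ A 0 = a ∧ A 1 = 0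

/-- ū₀(t) = |t| a. -/
def ub0 (a : V3) (t : ℝ) : V3 := |t| • a

/-- b̄₀(t) = A₃ for t ≥ 0, −A₃ (= B₃) for t < 0. -/
def bb0 (A3 : V3) (t : ℝ) : V3 := if 0 ≤ t then A3 else -A3

/-- u₀(x) = ū₀(x₁). -/
def u0 (a : V3) (x : Pt) : V3 := ub0 a x.1

/-- b₀(x) = b̄₀(x₁). -/
def b0 (A3 : V3) (x : Pt) : V3 := bb0 A3 x.1

/-- The interval I = (−1/2, 1/2). -/
def II : Set ℝ := Set.Ioo (-(1 / 2 : ℝ)) (1 / 2)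

/-- The unit cube Q = I × I × I. -/
def Q3 : Set Pt := II ×ˢ (II ×ˢ II)

/-- J_ρ = (ρ I) × J × I. -/
def Jrho (J : Set ℝ) (ρ : ℝ) : Set Pt := (Set.Ioo (-(ρ / 2)) (ρ / 2)) ×ˢ (J ×ˢ II)

/-- The rescaled thin domain Ω = ω × I. -/
def Om (ω : Set (ℝ × ℝ)) : Set Pt := {x | (x.1, x.2.1) ∈ ω ∧ x.2.2 ∈ II}

/-- L¹ convergence on a set U. -/
def TendsL1 (U : Set Pt) (f : ℕ → Pt → V3) (g : Pt → V3) : Prop :=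
  Tendsto (fun n => ∫⁻ x in U, ENNReal.ofReal (vnorm (f n x - g x))) atTop (nhds 0)

/-- L^q convergence on a set U. -/
def TendsLp (U : Set Pt) (q : ℝ) (f : ℕ → Pt → V3) (g : Pt → V3) : Prop :=
  Tendsto (fun n => ∫⁻ x in U, ENNReal.ofReal ((vnorm (f n x - g x)) ^ q)) atTop (nhds 0)

/-- The localized asymptotic energy 𝓔_γ(J, ρ). -/
def Egam (W : M33 → ℝ) (a A3 : V3) (γ : ℝ) (J : Set ℝ) (ρ : ℝ) : ℝ≥0∞ :=
  sInf { L : ℝ≥0∞ | ∃ (h ε : ℕ → ℝ) (u : ℕ → Pt → V3),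
    (∀ n, 0 < h n) ∧ (∀ n, 0 < ε n) ∧
    Tendsto h atTop (nhds 0) ∧ Tendsto ε atTop (nhds 0) ∧
    Tendsto (fun n => h n / ε n) atTop (nhds γ) ∧
    (∀ n, ContDiffOn ℝ 2 (u n) (Jrho J ρ)) ∧
    TendsL1 (Jrho J ρ) u (u0 a) ∧
    TendsL1 (Jrho J ρ) (fun n x => (h n)⁻¹ • pd e3 (u n) x) (b0 A3) ∧
    L = Filter.liminf (fun n => F W (h n) (ε n) (u n) (Jrho J ρ)) atTop }

/-- K*_γ = 𝓔_γ(I, 1). -/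
def Kstar (W : M33 → ℝ) (a A3 : V3) (γ : ℝ) : ℝ≥0∞ := Egam W a A3 γ II 1

/-- K*_∞ : the analogue of K*_γ for h/ε → ∞, on the unit cube Q. -/
def KstarInf (W : M33 → ℝ) (a A3 : V3) : ℝ≥0∞ :=
  sInf { L : ℝ≥0∞ | ∃ (h ε : ℕ → ℝ) (u : ℕ → Pt → V3),
    (∀ n, 0 < h n) ∧ (∀ n, 0 < ε n) ∧
    Tendsto h atTop (nhds 0) ∧ Tendsto ε atTop (nhds 0) ∧
    Tendsto (fun n => h n / ε n) atTop atTop ∧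
    (∀ n, ContDiffOn ℝ 2 (u n) Q3) ∧
    TendsL1 Q3 u (u0 a) ∧
    TendsL1 Q3 (fun n x => (h n)⁻¹ • pd e3 (u n) x) (b0 A3) ∧
    L = Filter.liminf (fun n => F W (h n) (ε n) (u n) Q3) atTop }

open Classical in
/-- The phase matrix: B on E, A off E. -/
def Mfun (A B : M33) (E : Set (ℝ × ℝ)) (x' : ℝ × ℝ) : M33 := if x' ∈ E then B else A

/-! ### Two-dimensional objects -/

abbrev Pt2 := ℝ × ℝ

/-- Directional partial derivative of a map `v : ℝ² → ℝ³`. -/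
def qd (e : Pt2) (v : Pt2 → V3) (y : Pt2) : V3 := fderiv ℝ v y e

def f1 : Pt2 := (1, 0)
def f2 : Pt2 := (0, 1)

/-- 𝒲(∇v) = W(∂₁v, 0, ∂₂v). -/
def W2 (W : M33 → ℝ) (v : Pt2 → V3) (y : Pt2) : ℝ := W ![qd f1 v y, 0, qd f2 v y]

/-- Squared 2D Hessian |∇²v|². -/
def hess2d (v : Pt2 → V3) (y : Pt2) : ℝ :=
  (vnorm (qd f1 (qd f1 v) y)) ^ 2 + 2 * (vnorm (qd f2 (qd f1 v) y)) ^ 2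
    + (vnorm (qd f2 (qd f2 v) y)) ^ 2

/-- The rectangle ℓI × γI. -/
def Rect (ℓ γ : ℝ) : Set Pt2 := Set.Ioo (-(ℓ / 2)) (ℓ / 2) ×ˢ Set.Ioo (-(γ / 2)) (γ / 2)

/-- The optimal-profile constant K_γ of the critical regime. -/
def Kgam (W : M33 → ℝ) (a A3 : V3) (γ : ℝ) : ℝ≥0∞ :=
  sInf { L : ℝ≥0∞ | ∃ ℓ > (0 : ℝ), ∃ v : Pt2 → V3,
    ContDiffOn ℝ 2 v (Rect ℓ γ) ∧
    (∃ δ > (0 : ℝ), ∀ y ∈ Rect ℓ γ, ℓ / 2 - δ < y.1 → qd f1 v y = a ∧ qd f2 v y = A3) ∧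
    (∃ δ > (0 : ℝ), ∀ y ∈ Rect ℓ γ, y.1 < -(ℓ / 2) + δ → qd f1 v y = -a ∧ qd f2 v y = -A3) ∧
    L = ENNReal.ofReal γ⁻¹ *
      ∫⁻ y in Rect ℓ γ, ENNReal.ofReal (W2 W v y + hess2d v y) }

/-- The 2D subcritical functional F⁰_ε(u, b, D). -/
def F0 (W : M33 → ℝ) (ε : ℝ) (u b : Pt2 → V3) (D : Set Pt2) : ℝ≥0∞ :=
  ∫⁻ y in D, ENNReal.ofReal (ε⁻¹ * W ![qd f1 u y, qd f2 u y, b y]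
    + ε * ((vnorm (qd f1 (qd f1 u) y)) ^ 2 + 2 * (vnorm (qd f2 (qd f1 u) y)) ^ 2
      + (vnorm (qd f2 (qd f2 u) y)) ^ 2
      + 2 * (vnorm (qd f1 b y)) ^ 2 + 2 * (vnorm (qd f2 b y)) ^ 2))

/-- K*₀: the subcritical cell constant. -/
def Kstar0 (W : M33 → ℝ) (a A3 : V3) : ℝ≥0∞ :=
  sInf { L : ℝ≥0∞ | ∃ (ε : ℕ → ℝ) (u b : ℕ → Pt2 → V3),
    (∀ n, 0 < ε n) ∧ Tendsto ε atTop (nhds 0) ∧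
    (∀ n, ContDiffOn ℝ 2 (u n) (II ×ˢ II)) ∧ (∀ n, ContDiffOn ℝ 1 (b n) (II ×ˢ II)) ∧
    Tendsto (fun n => ∫⁻ y in II ×ˢ II,
      ENNReal.ofReal (vnorm (u n y - ub0 a y.1) + vnorm (b n y - bb0 A3 y.1)))
      atTop (nhds 0) ∧
    L = Filter.liminf (fun n => F0 W (ε n) (u n) (b n) (II ×ˢ II)) atTop }

/-- K₀: the subcritical optimal-profile constant. -/
def K0 (W : M33 → ℝ) (a A3 : V3) : ℝ≥0∞ :=
  sInf { L : ℝ≥0∞ | ∃ ℓ > (0 : ℝ), ∃ φ1 φ2 : ℝ → V3,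
    ContDiffOn ℝ 1 φ1 (Set.Icc (-ℓ) ℓ) ∧ ContDiffOn ℝ 1 φ2 (Set.Icc (-ℓ) ℓ) ∧
    φ1 ℓ = a ∧ φ2 ℓ = A3 ∧ φ1 (-ℓ) = -a ∧ φ2 (-ℓ) = -A3 ∧
    L = ∫⁻ t in Set.Ioo (-ℓ) ℓ, ENNReal.ofReal (W ![φ1 t, 0, φ2 t]
      + (vnorm (derivWithin φ1 (Set.Icc (-ℓ) ℓ) t)) ^ 2
      + 2 * (vnorm (derivWithin φ2 (Set.Icc (-ℓ) ℓ) t)) ^ 2) }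

/-- K_∞ in the case λ = 0. -/
def KinfZero (W : M33 → ℝ) (a : V3) : ℝ≥0∞ :=
  sInf { L : ℝ≥0∞ | ∃ ℓ > (0 : ℝ), ∃ v : Pt2 → V3,
    ContDiff ℝ 2 v ∧ (∀ y : Pt2, v (y.1, y.2 + 1) = v y) ∧
    (∃ δ > (0 : ℝ), ∀ y : Pt2, |y.1 - 1 / 2| < δ → qd f1 v y = a ∧ qd f2 v y = 0) ∧
    (∃ δ > (0 : ℝ), ∀ y : Pt2, |y.1 + 1 / 2| < δ → qd f1 v y = -a ∧ qd f2 v y = 0) ∧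
    L = ∫⁻ y in II ×ˢ II, ENNReal.ofReal (ℓ * W2 W v y + ℓ⁻¹ * hess2d v y) }

/-- The unit normal ν_λ = (1+λ²)^{-1/2} (1, λ). -/
def nuv (lam : ℝ) : Pt2 := (1 / Real.sqrt (1 + lam ^ 2), lam / Real.sqrt (1 + lam ^ 2))

/-- The orthogonal direction ν_λ^⊥ = (1+λ²)^{-1/2} (−λ, 1). -/
def nupv (lam : ℝ) : Pt2 := (-lam / Real.sqrt (1 + lam ^ 2), 1 / Real.sqrt (1 + lam ^ 2))

/-- Dot product on ℝ². -/
def dotp (w y : Pt2) : ℝ := w.1 * y.1 + w.2 * y.2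

/-- The unit square Q'_λ centered at 0 with two sides orthogonal to ν_λ. -/
def Qlam (lam : ℝ) : Set Pt2 := {y | |dotp (nuv lam) y| < 1 / 2 ∧ |dotp (nupv lam) y| < 1 / 2}

/-- K_∞ for general λ. -/
def KinfL (W : M33 → ℝ) (a : V3) (lam : ℝ) : ℝ≥0∞ :=
  ENNReal.ofReal (Real.sqrt (1 + lam ^ 2)) *
    sInf { L : ℝ≥0∞ | ∃ ℓ > (0 : ℝ), ∃ v : Pt2 → V3,
      ContDiff ℝ 2 v ∧ (∀ y : Pt2, v (y + nupv lam) = v y) ∧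
      (∃ δ > (0 : ℝ), ∀ y : Pt2, |dotp (nuv lam) y - 1 / 2| < δ →
        qd f1 v y = a ∧ qd f2 v y = lam • a) ∧
      (∃ δ > (0 : ℝ), ∀ y : Pt2, |dotp (nuv lam) y + 1 / 2| < δ →
        qd f1 v y = -a ∧ qd f2 v y = -(lam • a)) ∧
      L = ∫⁻ y in Qlam lam, ENNReal.ofReal (ℓ * W2 W v y + ℓ⁻¹ * hess2d v y) }

/-- Number of interfaces strictly below t. -/
def cnt (m : ℕ) (α : Fin m → ℝ) (t : ℝ) : ℕ := (Finset.univ.filter (fun i => α i < t)).card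

/-- A `C¹` transition function that is constant outside `[-3/4, 3/4]`. -/
def cutoff (b : ℝ) : ℝ := ∫ s in (0 : ℝ)..b, max 0 (9 / 16 - s ^ 2)

lemma hasDerivAt_cutoff (b : ℝ) : HasDerivAt cutoff (max 0 (9 / 16 - b ^ 2)) b := by
  have hc : Continuous fun s : ℝ => max 0 (9 / 16 - s ^ 2) := by fun_prop
  exact intervalIntegral.integral_hasDerivAt_right (hc.intervalIntegrable _ _)
    (hc.stronglyMeasurableAtFilter _ _) hc.continuousAt

lemma deriv_cutoff : deriv cutoff = fun b => max 0 (9 / 16 - b ^ 2) :=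
  funext fun b => (hasDerivAt_cutoff b).deriv

lemma contDiff_cutoff : ContDiff ℝ 1 cutoff := by
  rw [contDiff_one_iff_deriv, deriv_cutoff]
  exact ⟨fun b => (hasDerivAt_cutoff b).differentiableAt, by fun_prop⟩

lemma abs_deriv_cutoff_le (b : ℝ) : |deriv cutoff b| ≤ 1 := by
  rw [deriv_cutoff, abs_of_nonneg (le_max_left _ _)]
  exact max_le zero_le_one (by nlinarith [sq_nonneg b])

lemma deriv_cutoff_eq_zero {b : ℝ} (hb : 3 / 4 ≤ |b|) : deriv cutoff b = 0 := by
  rw [deriv_cutoff]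
  exact max_eq_left (by nlinarith [sq_abs b])

lemma cutoff_monotone : Monotone cutoff :=
  monotone_of_deriv_nonneg (fun b => (hasDerivAt_cutoff b).differentiableAt) fun b => by
    rw [deriv_cutoff]; exact le_max_left _ _

lemma cutoff_eq {b : ℝ} (hb : |b| ≤ 3 / 4) : cutoff b = 9 / 16 * b - b ^ 3 / 3 := by
  have h : cutoff b = ∫ s in (0 : ℝ)..b, (9 / 16 - s ^ 2) := by
    refine intervalIntegral.integral_congr fun s hs => max_eq_right ?_
    have : |s| ≤ 3 / 4 := by
      have := abs_sub_left_of_mem_uIcc hs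
      simp only [sub_zero] at this
      exact this.trans hb
    nlinarith [sq_abs s, abs_nonneg s]
  rw [h, intervalIntegral.integral_sub (by simp) ((continuous_pow 2).intervalIntegrable _ _),
    integral_pow]
  simp
  ring

lemma le_abs_cutoff_sub {a b : ℝ} (ha : |a| ≤ 1 / 2) (hb : 3 / 4 ≤ |b|) :
    1 / 24 ≤ |cutoff a - cutoff b| := by
  have h1 := cutoff_eq (b := 1 / 2) (by norm_num [abs_of_pos])
  have h2 := cutoff_eq (b := -(1 / 2)) (by norm_num [abs_of_pos])
  have h3 := cutoff_eq (b := 3 / 4) (by norm_num [abs_of_pos])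
  have h4 := cutoff_eq (b := -(3 / 4)) (by norm_num [abs_of_pos])
  obtain ⟨ha1, ha2⟩ := abs_le.1 ha
  have h5 := cutoff_monotone ha1
  have h6 := cutoff_monotone ha2
  rcases le_abs'.1 hb with h | h
  · have := cutoff_monotone h
    exact le_trans (by linarith) (le_abs_self _)
  · have := cutoff_monotone h
    exact le_trans (by linarith) (neg_le_abs _)

lemma le_abs_cutoff_sub_of_opposite {a b : ℝ} (ha : 3 / 4 ≤ a) (hb : b ≤ -(3 / 4)) :
    1 / 24 ≤ |cutoff a - cutoff b| := by
  have h3 := cutoff_eq (b := 3 / 4) (by norm_num [abs_of_pos])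
  have h4 := cutoff_eq (b := -(3 / 4)) (by norm_num [abs_of_pos])
  have := cutoff_monotone ha
  have := cutoff_monotone hb
  exact le_trans (by linarith) (le_abs_self _)

lemma measurableSet_II : MeasurableSet II := measurableSet_Ioo

/-- A slope profile with small energy on `I` stays away from zero. -/
lemma slice_dichotomy {β : ℝ → ℝ} (hβ : ContDiffOn ℝ 1 β II) {D : ℝ → ℝ≥0∞} {κ : ℝ≥0∞}
    (hD : ∀ s ∈ II, |β s| ≤ 3 / 4 → 1 ≤ κ * D s ∧ ‖deriv β s‖ₑ ≤ κ * D s)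
    (hsmall : ∫⁻ s in II, κ * D s < ENNReal.ofReal (1 / 24)) :
    (∀ s ∈ II, 1 / 2 < β s) ∨ (∀ s ∈ II, β s < -(1 / 2)) := by
  have key : ∀ s ∈ II, 1 / 2 < |β s| := by
    by_contra! hcon
    obtain ⟨s, hs, hβs⟩ := hcon
    by_cases hall : ∀ r ∈ II, |β r| ≤ 3 / 4
    · have h1 : ∫⁻ _ in II, (1 : ℝ≥0∞) ≤ ∫⁻ r in II, κ * D r :=
        setLIntegral_mono' measurableSet_II fun r hr => (hD r hr (hall r hr)).1
      have h2 : ∫⁻ _ in II, (1 : ℝ≥0∞) = 1 := by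
        simp only [lintegral_const, Measure.restrict_apply_univ, II, Real.volume_Ioo]
        norm_num
      rw [h2] at h1
      refine absurd (h1.trans_lt hsmall) (not_lt.2 ?_)
      rw [← ENNReal.ofReal_one]
      exact ENNReal.ofReal_le_ofReal (by norm_num)
    · push Not at hall
      obtain ⟨r, hr, hβr⟩ := hall
      have hvar : ∀ a ∈ II, ∀ b ∈ II, a ≤ b →
          ‖cutoff (β b) - cutoff (β a)‖ₑ ≤ ∫⁻ s in II, κ * D s := by
        intro a ha b hb hab
        have hsub : Icc a b ⊆ II := ordConnected_Ioo.out ha hb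
        refine (enorm_sub_le_lintegral_deriv_of_contDiffOn_Icc (f := cutoff ∘ β)
          (contDiff_cutoff.comp_contDiffOn (hβ.mono hsub)) hab).trans ?_
        refine (setLIntegral_mono' measurableSet_Icc fun x hx => ?_).trans
          (lintegral_mono_set hsub)
        have hd : DifferentiableAt ℝ β x :=
          (hβ.differentiableOn (by simp)).differentiableAt (isOpen_Ioo.mem_nhds (hsub hx))
        rw [deriv_comp x (hasDerivAt_cutoff _).differentiableAt hd, enorm_mul]
        by_cases hx' : |β x| ≤ 3 / 4
        · calc _ ≤ 1 * ‖deriv β x‖ₑ := by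
                gcongr
                rw [← enorm_one (G := ℝ), enorm_le_iff_norm_le]
                simpa using abs_deriv_cutoff_le (β x)
            _ ≤ _ := by simpa using (hD x (hsub hx) hx').2
        · simp [deriv_cutoff_eq_zero (not_le.1 hx').le]
      have hge : ENNReal.ofReal (1 / 24) ≤ ‖cutoff (β s) - cutoff (β r)‖ₑ := by
        rw [Real.enorm_eq_ofReal_abs]
        exact ENNReal.ofReal_le_ofReal (le_abs_cutoff_sub hβs hβr.le)
      rcases le_total r s with h | h
      · exact absurd ((hge.trans (hvar r hr s hs h)).trans_lt hsmall) (lt_irrefl _)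
      · rw [enorm_sub_rev] at hge
        exact absurd ((hge.trans (hvar s hs r hr h)).trans_lt hsmall) (lt_irrefl _)
  have hpre : IsPreconnected (β '' II) := isPreconnected_Ioo.image _ hβ.continuousOn
  by_contra! hcon
  obtain ⟨⟨s, hs, hs'⟩, ⟨r, hr, hr'⟩⟩ := hcon
  have h1 : β s ≤ 0 := by
    rcases lt_abs.1 (key s hs) with h | h <;> linarith
  have h2 : 0 ≤ β r := by
    rcases lt_abs.1 (key r hr) with h | h <;> linarith
  obtain ⟨z, hz, hz0⟩ := hpre.ordConnected.out (mem_image_of_mem β hs) (mem_image_of_mem β hr)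
    ⟨h1, h2⟩
  have := key z hz
  rw [hz0] at this
  norm_num at this

lemma lintegral_comp_add_smul {E : Type*} [NormedAddCommGroup E] [NormedSpace ℝ E]
    [MeasurableSpace E] [BorelSpace E] [FiniteDimensional ℝ E] (μ : Measure E)
    [μ.IsAddHaarMeasure] {k : E → ℝ≥0∞} (hk : Measurable k) (c : E) {r : ℝ} (hr : r ≠ 0) :
    ∫⁻ y, k (c + r • y) ∂μ
      = ENNReal.ofReal |(r ^ Module.finrank ℝ E)⁻¹| * ∫⁻ y, k y ∂μ := by
  have hk' : Measurable fun y => k (c + y) := by fun_prop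
  rw [← lintegral_map (f := fun y => k (c + y)) (g := fun y : E => r • y) hk' (by fun_prop),
    Measure.map_addHaar_smul μ hr, lintegral_smul_measure, lintegral_add_left_eq_self, smul_eq_mul]

/-- Poincaré inequality in double-difference form on a convex open set. -/
lemma lintegral_enorm_sub_le_of_convex {E : Type*} [NormedAddCommGroup E] [NormedSpace ℝ E]
    [MeasurableSpace E] [BorelSpace E] [FiniteDimensional ℝ E] (μ : Measure E)
    [μ.IsAddHaarMeasure] {s : Set E} (hso : IsOpen s) (hsc : Convex ℝ s) {d : ℝ}
    (hd : ∀ x ∈ s, ∀ y ∈ s, ‖y - x‖ ≤ d) {g : E → ℝ} (hg : ContDiffOn ℝ 1 g s) :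
    ∫⁻ x in s, ∫⁻ y in s, ‖g y - g x‖ₑ ∂μ ∂μ ≤
      ENNReal.ofReal d * (2 * 2 ^ Module.finrank ℝ E) * μ s * ∫⁻ z in s, ‖fderiv ℝ g z‖ₑ ∂μ := by
  set k : E → ℝ≥0∞ := s.indicator fun z => ‖fderiv ℝ g z‖ₑ with hkdef
  have hkm : Measurable k := by
    have := (measurable_fderiv ℝ g).enorm
    exact this.indicator hso.measurableSet
  have hkint : ∫⁻ z, k z ∂μ = ∫⁻ z in s, ‖fderiv ℝ g z‖ₑ ∂μ :=
    lintegral_indicator hso.measurableSet _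
  have hpt : ∀ x ∈ s, ∀ y ∈ s, ‖g y - g x‖ₑ ≤
      ENNReal.ofReal d * ∫⁻ r in Icc (0 : ℝ) 1, k ((1 - r) • x + r • y) := by
    intro x hx y hy
    set γ : ℝ → E := fun r => (1 - r) • x + r • y with hγ
    have hγs : ∀ r ∈ Icc (0 : ℝ) 1, γ r ∈ s := fun r hr =>
      hsc hx hy (by linarith [hr.2]) hr.1 (by ring)
    have hγd : ∀ r, HasDerivAt γ (y - x) r := by
      intro r
      have h1 : HasDerivAt (fun r : ℝ => (1 - r) • x) ((-1 : ℝ) • x) r :=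
        ((hasDerivAt_id r).const_sub 1).smul_const x
      have h2 : HasDerivAt (fun r : ℝ => r • y) ((1 : ℝ) • y) r :=
        (hasDerivAt_id r).smul_const y
      exact (h1.add h2).congr_deriv (by module)
    have hγc : ContDiff ℝ 1 γ := by
      simp only [hγ]; fun_prop
    have h := enorm_sub_le_lintegral_deriv_of_contDiffOn_Icc (f := g ∘ γ)
      (hg.comp hγc.contDiffOn hγs) zero_le_one
    simp only [Function.comp, hγ, sub_self, zero_smul, one_smul, zero_add, sub_zero,
      add_zero] at h
    refine h.trans ?_
    rw [← lintegral_const_mul' _ _ ENNReal.ofReal_ne_top]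
    refine setLIntegral_mono' measurableSet_Icc fun r hr => ?_
    have hgd : HasFDerivAt g (fderiv ℝ g (γ r)) (γ r) :=
      ((hg.differentiableOn (by simp)).differentiableAt (hso.mem_nhds (hγs r hr))).hasFDerivAt
    have hder : deriv (g ∘ fun r => (1 - r) • x + r • y) r = fderiv ℝ g (γ r) (y - x) :=
      (hgd.comp_hasDerivAt r (hγd r)).deriv
    have hkγ : k ((1 - r) • x + r • y) = ‖fderiv ℝ g (γ r)‖ₑ :=
      indicator_of_mem (hγs r hr) _
    rw [hder, hkγ, mul_comm]
    refine (ContinuousLinearMap.le_opENorm _ _).trans ?_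
    gcongr
    rw [← ofReal_norm]
    exact ENNReal.ofReal_le_ofReal (hd x hx y hy)
  have hscale : ∀ r : ℝ, 1 / 2 ≤ r → ∀ c : E,
      ∫⁻ y in s, k (c + r • y) ∂μ ≤ 2 ^ Module.finrank ℝ E * ∫⁻ z, k z ∂μ := by
    intro r hr c
    refine (setLIntegral_le_lintegral _ _).trans ?_
    rw [lintegral_comp_add_smul μ hkm c (by linarith : r ≠ 0)]
    gcongr
    rw [abs_of_nonneg (by positivity), ← inv_pow, ENNReal.ofReal_pow (by positivity)]
    gcongr
    rw [← ENNReal.ofReal_ofNat 2]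
    refine ENNReal.ofReal_le_ofReal ?_
    rw [inv_le_comm₀ (by linarith) (by norm_num)]
    linarith
  have hdouble : ∀ r ∈ Icc (0 : ℝ) 1, ∫⁻ x in s, ∫⁻ y in s, k ((1 - r) • x + r • y) ∂μ ∂μ ≤
      2 ^ Module.finrank ℝ E * μ s * ∫⁻ z, k z ∂μ := by
    intro r hr
    rcases le_total (1 / 2) r with h | h
    · refine (lintegral_mono fun x => hscale r h ((1 - r) • x)).trans ?_
      rw [lintegral_const, Measure.restrict_apply_univ, mul_right_comm]
    · rw [lintegral_lintegral_swap (by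
        apply Measurable.aemeasurable
        simp only [Function.uncurry_def]
        fun_prop)]
      refine (lintegral_mono fun y => ?_).trans_eq
        (lintegral_const (2 ^ Module.finrank ℝ E * ∫⁻ z, k z ∂μ) |>.trans ?_)
      · simp only [add_comm _ (r • y)]
        exact hscale (1 - r) (by linarith) (r • y)
      · rw [Measure.restrict_apply_univ, mul_right_comm]
  calc ∫⁻ x in s, ∫⁻ y in s, ‖g y - g x‖ₑ ∂μ ∂μ
      ≤ ∫⁻ x in s, ∫⁻ y in s,
          ENNReal.ofReal d * (∫⁻ r in Icc (0 : ℝ) 1, k ((1 - r) • x + r • y)) ∂μ ∂μ :=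
        setLIntegral_mono' hso.measurableSet fun x hx =>
          setLIntegral_mono' hso.measurableSet fun y hy => hpt x hx y hy
    _ = ENNReal.ofReal d * ∫⁻ x in s, ∫⁻ y in s,
          (∫⁻ r in Icc (0 : ℝ) 1, k ((1 - r) • x + r • y)) ∂μ ∂μ := by
        simp_rw [lintegral_const_mul' _ _ ENNReal.ofReal_ne_top]
    _ = ENNReal.ofReal d * ∫⁻ r in Icc (0 : ℝ) 1, (∫⁻ x in s,
          ∫⁻ y in s, k ((1 - r) • x + r • y) ∂μ ∂μ) := by
        congr 1
        have hswap : ∀ x : E, ∫⁻ y in s, (∫⁻ r in Icc (0 : ℝ) 1, k ((1 - r) • x + r • y)) ∂μ =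
            ∫⁻ r in Icc (0 : ℝ) 1, (∫⁻ y in s, k ((1 - r) • x + r • y) ∂μ) := fun x => by
          refine lintegral_lintegral_swap (Measurable.aemeasurable ?_)
          simp only [Function.uncurry_def]
          fun_prop
        simp_rw [hswap]
        refine lintegral_lintegral_swap (Measurable.aemeasurable ?_)
        simp only [Function.uncurry_def]
        apply Measurable.lintegral_prod_right'
          (f := fun q : (E × ℝ) × E => k ((1 - q.1.2) • q.1.1 + q.1.2 • q.2))
        fun_prop
    _ ≤ ENNReal.ofReal d * ∫⁻ _ in Icc (0 : ℝ) 1,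
          (2 * (2 ^ Module.finrank ℝ E * μ s * ∫⁻ z, k z ∂μ)) := by
        refine mul_le_mul_right ?_ _
        refine setLIntegral_mono' measurableSet_Icc fun r hr => (hdouble r hr).trans ?_
        exact le_mul_of_one_le_left' (by norm_num)
    _ = _ := by
        rw [lintegral_const, Measure.restrict_apply_univ, Real.volume_Icc, hkint]
        norm_num
        ring

lemma ENNReal.add_sq_le_four_mul (a b : ℝ≥0∞) : (a + b) ^ 2 ≤ 4 * (a ^ 2 + b ^ 2) := by
  rcases le_total a b with h | h
  · calc (a + b) ^ 2 ≤ (b + b) ^ 2 := by gcongr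
      _ = 4 * b ^ 2 := by ring
      _ ≤ _ := by gcongr; exact le_add_self
  · calc (a + b) ^ 2 ≤ (a + a) ^ 2 := by gcongr
      _ = 4 * a ^ 2 := by ring
      _ ≤ _ := by gcongr; exact le_self_add

lemma ENNReal.le_mul_sq_add_inv {η : ℝ≥0∞} (h0 : η ≠ 0) (ht : η ≠ ⊤) (a : ℝ≥0∞) :
    a ≤ η * a ^ 2 + η⁻¹ := by
  rcases le_total a η⁻¹ with h | h
  · exact h.trans le_add_self
  · refine le_trans ?_ le_self_add
    calc a = 1 * a := (one_mul a).symm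
      _ = η * η⁻¹ * a := by rw [ENNReal.mul_inv_cancel h0 ht]
      _ ≤ η * a * a := by gcongr
      _ = η * a ^ 2 := by ring

/-- If `G` is rarely in `(-1/4, 1/4)` and has square-integrable gradient, then one of the sets
`{1/4 ≤ G}`, `{G ≤ -1/4}` is small. -/
lemma measure_superlevel_mul_sublevel_le {E : Type*} [NormedAddCommGroup E] [NormedSpace ℝ E]
    [MeasurableSpace E] [BorelSpace E] [FiniteDimensional ℝ E] (μ : Measure E)
    [μ.IsAddHaarMeasure] {s : Set E} (hso : IsOpen s) (hsc : Convex ℝ s) {d : ℝ}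
    (hd : ∀ x ∈ s, ∀ y ∈ s, ‖y - x‖ ≤ d) {G : E → ℝ} (hG : ContDiffOn ℝ 1 G s)
    {Q : E → ℝ≥0∞} (hQ : ∀ z ∈ s, ‖fderiv ℝ G z‖ₑ ^ 2 ≤ Q z) {η : ℝ≥0∞} (h0 : η ≠ 0)
    (ht : η ≠ ⊤) :
    ENNReal.ofReal (1 / 24) * (μ {z ∈ s | 1 / 4 ≤ G z} * μ {z ∈ s | G z ≤ -(1 / 4)}) ≤
      ENNReal.ofReal d * (2 * 2 ^ Module.finrank ℝ E) * μ s *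
        (3 * (η * ∫⁻ z in s, Q z ∂μ + η⁻¹ * μ {z ∈ s | |G z| < 1 / 4})) := by
  set P := {z ∈ s | 1 / 4 ≤ G z}
  set N := {z ∈ s | G z ≤ -(1 / 4)}
  set R := {z ∈ s | |G z| < 1 / 4} with hR
  have hlevel : ∀ {T : Set ℝ}, MeasurableSet T → MeasurableSet {z ∈ s | G z ∈ T} := by
    intro T hT
    obtain ⟨g', hg', heq⟩ : ∃ g' : E → ℝ, Measurable g' ∧ EqOn G g' s := by
      classical
      exact ⟨s.piecewise G 0,
        hG.continuousOn.measurable_piecewise continuousOn_const hso.measurableSet,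
        fun z hz => (piecewise_eq_of_mem _ _ _ hz).symm⟩
    have : {z ∈ s | G z ∈ T} = s ∩ g' ⁻¹' T := by
      ext z
      exact and_congr_right fun hz => by rw [heq hz, mem_preimage]
    rw [this]
    exact hso.measurableSet.inter (hg' hT)
  have hP : MeasurableSet P := hlevel measurableSet_Ici
  have hN : MeasurableSet N := hlevel measurableSet_Iic
  have hRm : MeasurableSet R := by
    have : R = {z ∈ s | G z ∈ Ioo (-(1 / 4)) (1 / 4)} := by
      ext z; simp only [hR, mem_ofPred_eq, abs_lt, mem_Ioo]
    rw [this]; exact hlevel measurableSet_Ioo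
  set g : E → ℝ := fun z => cutoff (3 * G z)
  have hg : ContDiffOn ℝ 1 g s := contDiff_cutoff.comp_contDiffOn (contDiffOn_const.mul hG)
  have hlow : ENNReal.ofReal (1 / 24) * (μ P * μ N) ≤
      ∫⁻ x in s, ∫⁻ y in s, ‖g y - g x‖ₑ ∂μ ∂μ := by
    calc ENNReal.ofReal (1 / 24) * (μ P * μ N)
        = ∫⁻ _ in N, ∫⁻ _ in P, ENNReal.ofReal (1 / 24) ∂μ ∂μ := by
          simp only [lintegral_const, Measure.restrict_apply_univ]; ring
      _ ≤ ∫⁻ x in N, ∫⁻ y in P, ‖g y - g x‖ₑ ∂μ ∂μ := by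
          refine setLIntegral_mono' hN fun x hx => setLIntegral_mono' hP fun y hy => ?_
          rw [Real.enorm_eq_ofReal_abs]
          exact ENNReal.ofReal_le_ofReal (le_abs_cutoff_sub_of_opposite
            (by linarith [hy.2]) (by linarith [hx.2]))
      _ ≤ ∫⁻ x in N, ∫⁻ y in s, ‖g y - g x‖ₑ ∂μ ∂μ :=
          lintegral_mono fun x => lintegral_mono_set fun y hy => hy.1
      _ ≤ _ := lintegral_mono_set fun y hy => hy.1
  have hgrad : ∫⁻ z in s, ‖fderiv ℝ g z‖ₑ ∂μ ≤
      3 * (η * ∫⁻ z in s, Q z ∂μ + η⁻¹ * μ R) := by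
    calc ∫⁻ z in s, ‖fderiv ℝ g z‖ₑ ∂μ
        ≤ ∫⁻ z in s, 3 * (η * Q z + R.indicator (fun _ => η⁻¹) z) ∂μ := by
          refine setLIntegral_mono' hso.measurableSet fun z hz => ?_
          have hGz : DifferentiableAt ℝ G z :=
            (hG.differentiableOn (by simp)).differentiableAt (hso.mem_nhds hz)
          have hder : fderiv ℝ g z = (deriv cutoff (3 * G z) * 3) • fderiv ℝ G z := by
            have h1 : HasFDerivAt (fun z => 3 * G z) ((3 : ℝ) • fderiv ℝ G z) z :=
              hGz.hasFDerivAt.const_mul 3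
            rw [mul_smul, deriv_cutoff]
            exact ((hasDerivAt_cutoff (3 * G z)).comp_hasFDerivAt z h1).fderiv
          rw [hder, enorm_smul]
          by_cases hzR : |G z| < 1 / 4
          · rw [indicator_of_mem (show z ∈ R from ⟨hz, hzR⟩)]
            have h3 : ‖deriv cutoff (3 * G z) * 3‖ₑ ≤ 3 := by
              rw [Real.enorm_eq_ofReal_abs, abs_mul, ← ENNReal.ofReal_ofNat 3]
              refine ENNReal.ofReal_le_ofReal ?_
              have := abs_deriv_cutoff_le (3 * G z)
              rw [abs_of_pos (by norm_num : (0 : ℝ) < 3)]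
              linarith
            refine mul_le_mul' h3 ((ENNReal.le_mul_sq_add_inv h0 ht _).trans ?_)
            gcongr
            exact hQ z hz
          · have : 3 / 4 ≤ |3 * G z| := by
              rw [abs_mul, abs_of_pos (by norm_num : (0 : ℝ) < 3)]
              linarith [not_lt.1 hzR]
            simp [deriv_cutoff_eq_zero this]
      _ = 3 * (η * ∫⁻ z in s, Q z ∂μ + ∫⁻ z in s, R.indicator (fun _ => η⁻¹) z ∂μ) := by
          rw [lintegral_const_mul' _ _ (by simp),
            lintegral_add_right _ (measurable_const.indicator hRm), lintegral_const_mul' _ _ ht]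
      _ ≤ _ := by
          gcongr
          refine (setLIntegral_le_lintegral _ _).trans ?_
          rw [lintegral_indicator_const hRm]
  exact (hlow.trans (lintegral_enorm_sub_le_of_convex μ hso hsc hd hg)).trans
    (mul_le_mul_right hgrad _)

lemma volume_II : volume II = 1 := by
  rw [II, Real.volume_Ioo]; norm_num

lemma preimage_prodAssoc_Om (ω : Set (ℝ × ℝ)) :
    MeasurableEquiv.prodAssoc ⁻¹' Om ω = ω ×ˢ II := rfl

lemma isOpen_Om {ω : Set (ℝ × ℝ)} (hω : IsOpen ω) : IsOpen (Om ω) :=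
  (hω.preimage (by fun_prop : Continuous fun x : Pt => (x.1, x.2.1))).inter
    (isOpen_Ioo.preimage (by fun_prop : Continuous fun x : Pt => x.2.2))

lemma lintegral_Om {ω : Set (ℝ × ℝ)} (hω : IsOpen ω) {D : Pt → ℝ≥0∞} (hD : Measurable D) :
    ∫⁻ x in Om ω, D x = ∫⁻ z in ω, ∫⁻ s in II, D (z.1, z.2, s) := by
  rw [← (volume_preserving_prodAssoc (α₁ := ℝ) (β₁ := ℝ) (γ₁ := ℝ)).setLIntegral_comp_preimage
    (isOpen_Om hω).measurableSet hD, preimage_prodAssoc_Om, Measure.volume_eq_prod,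
    ← Measure.prod_restrict, lintegral_prod]
  · rfl
  · exact (hD.comp MeasurableEquiv.prodAssoc.measurable).aemeasurable

lemma volume_le_of_forall_mem_Om {ω S : Set (ℝ × ℝ)} {T : Set Pt} (hT : T ⊆ Om ω)
    (h : ∀ x ∈ T, (x.1, x.2.1) ∈ S) : volume T ≤ volume S := by
  rw [← (volume_preserving_prodAssoc (α₁ := ℝ) (β₁ := ℝ) (γ₁ := ℝ)).measure_preimage_equiv T]
  calc volume (MeasurableEquiv.prodAssoc ⁻¹' T) ≤ volume (S ×ˢ II) :=
        measure_mono fun x hx => ⟨h _ hx, (hT hx).2⟩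
    _ = volume S := by
        rw [Measure.volume_eq_prod, Measure.prod_prod, volume_II, mul_one]

/-- Two horizontal slices at distance `1/2` on which the density is controlled. -/
lemma exists_good_slices {ω : Set (ℝ × ℝ)} (hω : IsOpen ω) {D : Pt → ℝ≥0∞} (hD : Measurable D) :
    ∃ t ∈ Ioo (-(1 / 2) : ℝ) 0,
      ∫⁻ z in ω, D (z.1, z.2, t + 1 / 2) + D (z.1, z.2, t) ≤ 2 * ∫⁻ x in Om ω, D x := by
  set S : ℝ → ℝ≥0∞ := fun t => ∫⁻ z in ω, D (z.1, z.2, t) with hS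
  have hSm : Measurable S :=
    Measurable.lintegral_prod_right' (f := fun q : ℝ × ℝ × ℝ => D (q.2.1, q.2.2, q.1)) (by fun_prop)
  have hsum : ∀ t, ∫⁻ z in ω, D (z.1, z.2, t + 1 / 2) + D (z.1, z.2, t) = S (t + 1 / 2) + S t :=
    fun t => lintegral_add_left (by fun_prop) _
  have hvol : volume (Ioo (-(1 / 2) : ℝ) 0) = 2⁻¹ := by
    rw [Real.volume_Ioo, show (0 : ℝ) - -(1 / 2) = 2⁻¹ by norm_num,
      ENNReal.ofReal_inv_of_pos two_pos, ENNReal.ofReal_ofNat]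
  obtain ⟨t, ht, hle⟩ := exists_le_setLAverage (μ := volume) (s := Ioo (-(1 / 2) : ℝ) 0)
    (f := fun t => S (t + 1 / 2) + S t) (by simp) (by simp)
    (Measurable.aemeasurable (by fun_prop))
  refine ⟨t, ht, (hsum t).trans_le (hle.trans ?_)⟩
  rw [setLAverage_eq, hvol, div_eq_mul_inv, inv_inv, mul_comm]
  refine mul_le_mul_right ?_ _
  have hshift : ∫⁻ t in Ioo (-(1 / 2) : ℝ) 0, S (t + 1 / 2) = ∫⁻ t in Ioo (0 : ℝ) (1 / 2), S t := by
    rw [← (measurePreserving_add_right volume (1 / 2 : ℝ)).setLIntegral_comp_preimage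
      measurableSet_Ioo hSm]
    simp
  calc ∫⁻ t in Ioo (-(1 / 2) : ℝ) 0, (S (t + 1 / 2) + S t)
      = ∫⁻ t in Ioo (0 : ℝ) (1 / 2) ∪ Ioo (-(1 / 2) : ℝ) 0, S t := by
        rw [lintegral_add_right _ hSm, hshift, lintegral_union measurableSet_Ioo]
        exact disjoint_left.2 fun x hx hx' => lt_asymm hx.1 hx'.2
    _ ≤ ∫⁻ t in II, S t := by
        refine lintegral_mono_set (union_subset ?_ ?_) <;>
        · exact Ioo_subset_Ioo (by norm_num) (by norm_num)
    _ = ∫⁻ x in Om ω, D x := by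
        rw [lintegral_Om hω hD]
        refine lintegral_lintegral_swap (Measurable.aemeasurable ?_)
        simp only [Function.uncurry_def]
        fun_prop

lemma fderiv_horizontal_slice {ω : Set (ℝ × ℝ)} (hω : IsOpen ω) {f : Pt → ℝ}
    (hf : ContDiffOn ℝ 1 f (Om ω)) {s : ℝ} (hs : s ∈ II) :
    ContDiffOn ℝ 1 (fun z : ℝ × ℝ => f (z.1, z.2, s)) ω ∧ ∀ z ∈ ω,
      ‖fderiv ℝ (fun z : ℝ × ℝ => f (z.1, z.2, s)) z‖ₑ ≤
        ‖fderiv ℝ f (z.1, z.2, s) e1‖ₑ + ‖fderiv ℝ f (z.1, z.2, s) e2‖ₑ := by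
  have hmaps : MapsTo (fun z : ℝ × ℝ => ((z.1, z.2, s) : Pt)) ω (Om ω) := fun z hz => ⟨hz, hs⟩
  refine ⟨hf.comp (by fun_prop) hmaps, fun z hz => ?_⟩
  have hfz : HasFDerivAt f (fderiv ℝ f (z.1, z.2, s)) (z.1, z.2, s) :=
    ((hf.differentiableOn (by simp)).differentiableAt
      ((isOpen_Om hω).mem_nhds (hmaps hz))).hasFDerivAt
  have hι : HasFDerivAt (fun z : ℝ × ℝ => ((z.1, z.2, s) : Pt))
      ((ContinuousLinearMap.fst ℝ ℝ ℝ).prod ((ContinuousLinearMap.snd ℝ ℝ ℝ).prod 0)) z :=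
    hasFDerivAt_fst.prodMk (hasFDerivAt_snd.prodMk (hasFDerivAt_const s z))
  have hder : fderiv ℝ (fun z : ℝ × ℝ => f (z.1, z.2, s)) z = _ := (hfz.comp z hι).fderiv
  rw [hder, ← ofReal_norm, ← ofReal_norm, ← ofReal_norm,
    ← ENNReal.ofReal_add (norm_nonneg _) (norm_nonneg _)]
  refine ENNReal.ofReal_le_ofReal
    (ContinuousLinearMap.opNorm_le_bound _ (by positivity) fun v => ?_)
  have hv : ((v.1, v.2, 0) : Pt) = v.1 • e1 + v.2 • e2 := by simp [e1, e2]
  have hval : (fderiv ℝ f (z.1, z.2, s) ∘L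
      ((ContinuousLinearMap.fst ℝ ℝ ℝ).prod ((ContinuousLinearMap.snd ℝ ℝ ℝ).prod 0))) v =
      v.1 • fderiv ℝ f (z.1, z.2, s) e1 + v.2 • fderiv ℝ f (z.1, z.2, s) e2 := by
    rw [← map_smul, ← map_smul, ← map_add, ← hv]
    rfl
  rw [hval]
  refine (norm_add_le _ _).trans ?_
  rw [norm_smul, norm_smul, add_mul, mul_comm, mul_comm ‖v.2‖]
  gcongr
  · exact norm_fst_le v
  · exact norm_snd_le v

lemma hasDerivAt_vertical_slice {ω : Set (ℝ × ℝ)} (hω : IsOpen ω) {f : Pt → ℝ}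
    (hf : ContDiffOn ℝ 1 f (Om ω)) {z : ℝ × ℝ} (hz : z ∈ ω) {s : ℝ} (hs : s ∈ II) :
    HasDerivAt (fun s => f (z.1, z.2, s)) (fderiv ℝ f (z.1, z.2, s) e3) s := by
  have hfz : HasFDerivAt f (fderiv ℝ f (z.1, z.2, s)) (z.1, z.2, s) :=
    ((hf.differentiableOn (by simp)).differentiableAt
      ((isOpen_Om hω).mem_nhds ⟨hz, hs⟩)).hasFDerivAt
  exact hfz.comp_hasDerivAt s
    ((hasDerivAt_const s z.1).prodMk ((hasDerivAt_const s z.2).prodMk (hasDerivAt_id s)))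

/-- Slopes of size close to one with controlled energy have an essentially constant sign: the
product of the measures of `{β < 0}` and `{0 < β}` is at most of order `η`. -/
lemma exists_measure_neg_mul_pos_le {ω : Set (ℝ × ℝ)} (hωo : IsOpen ω) (hωc : Convex ℝ ω)
    (hωb : Bornology.IsBounded ω) {K : ℝ≥0∞} (hK : K ≠ ⊤) :
    ∃ C : ℝ≥0∞, C ≠ ⊤ ∧ ∀ (η : ℝ≥0∞) (f β : Pt → ℝ) (D : Pt → ℝ≥0∞), η ≠ 0 → η ≤ 1 →
      ContDiffOn ℝ 1 f (Om ω) → ContDiffOn ℝ 1 β (Om ω) →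
      (∀ x ∈ Om ω, fderiv ℝ f x e3 = β x) → Measurable D →
      (∀ x ∈ Om ω, ‖fderiv ℝ f x e1‖ₑ ^ 2 ≤ K * (1 + D x)) →
      (∀ x ∈ Om ω, ‖fderiv ℝ f x e2‖ₑ ^ 2 ≤ K * (1 + D x)) →
      (∀ x ∈ Om ω, |β x| ≤ 3 / 4 →
        1 ≤ K * η ^ 2 * D x ∧ ‖fderiv ℝ β x e3‖ₑ ≤ K * η ^ 2 * D x) →
      ∫⁻ x in Om ω, D x ≤ K →
      volume {x ∈ Om ω | β x < 0} * volume {x ∈ Om ω | 0 < β x} ≤ C * η := by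
  obtain ⟨d, hd⟩ := (Metric.isBounded_iff.1 hωb)
  have hvω : volume ω ≠ ⊤ := hωb.measure_lt_top.ne
  set c : ℝ≥0∞ := ENNReal.ofReal (1 / 24)
  have hc0 : c ≠ 0 := by simp [c]
  have hct : c ≠ ⊤ := ENNReal.ofReal_ne_top
  set b : ℝ≥0∞ := K * K / c
  have hb : b ≠ ⊤ := ENNReal.div_ne_top (ENNReal.mul_ne_top hK hK) hc0
  set C₁ : ℝ≥0∞ := ENNReal.ofReal d * (2 * 2 ^ Module.finrank ℝ (ℝ × ℝ)) * volume ω *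
    (3 * (32 * K * (2 * volume ω + 2 * K) + b)) / c
  have hC₁ : C₁ ≠ ⊤ := by
    refine ENNReal.div_ne_top ?_ hc0
    finiteness
  have hcC : c * C₁ = _ := ENNReal.mul_div_cancel hc0 hct
  refine ⟨C₁ + b * (3 * volume ω), by finiteness, ?_⟩
  intro η f β D hη0 hη1 hf hβ hfβ hDm h1 h2 h3 hDK
  have hηt : η ≠ ⊤ := ne_top_of_le_ne_top ENNReal.one_ne_top hη1
  obtain ⟨t, ht, hslice⟩ := exists_good_slices hωo hDm
  have htI : t ∈ II := ⟨ht.1, by linarith [ht.2]⟩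
  have htI' : t + 1 / 2 ∈ II := ⟨by linarith [ht.1], by linarith [ht.2]⟩
  set G : ℝ × ℝ → ℝ := fun z => f (z.1, z.2, t + 1 / 2) - f (z.1, z.2, t) with hGdef
  have hG1 := (fderiv_horizontal_slice hωo hf htI').1
  have hG2 := (fderiv_horizontal_slice hωo hf htI).1
  have hG : ContDiffOn ℝ 1 G ω := hG1.sub hG2
  set P := {z ∈ ω | 1 / 4 ≤ G z}
  set N := {z ∈ ω | G z ≤ -(1 / 4)}
  set R := {z ∈ ω | |G z| < 1 / 4}
  set Bad := {z ∈ ω | c ≤ ∫⁻ s in II, K * η ^ 2 * D (z.1, z.2, s)}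
  have hsq : ∀ s ∈ II, ∀ z ∈ ω, ‖fderiv ℝ (fun z : ℝ × ℝ => f (z.1, z.2, s)) z‖ₑ ^ 2 ≤
      8 * K * (1 + D (z.1, z.2, s)) := by
    intro s hs z hz
    calc _ ≤ (‖fderiv ℝ f (z.1, z.2, s) e1‖ₑ + ‖fderiv ℝ f (z.1, z.2, s) e2‖ₑ) ^ 2 := by
          gcongr
          exact (fderiv_horizontal_slice hωo hf hs).2 z hz
      _ ≤ 4 * (K * (1 + D (z.1, z.2, s)) + K * (1 + D (z.1, z.2, s))) := by
          refine (ENNReal.add_sq_le_four_mul _ _).trans ?_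
          gcongr
          · exact h1 _ ⟨hz, hs⟩
          · exact h2 _ ⟨hz, hs⟩
      _ = _ := by ring
  have hQ : ∀ z ∈ ω, ‖fderiv ℝ G z‖ₑ ^ 2 ≤
      32 * K * (2 + (D (z.1, z.2, t + 1 / 2) + D (z.1, z.2, t))) := by
    intro z hz
    have hd1 := (hG1.differentiableOn (by simp)).differentiableAt (hωo.mem_nhds hz)
    have hd2 := (hG2.differentiableOn (by simp)).differentiableAt (hωo.mem_nhds hz)
    have : fderiv ℝ G z = fderiv ℝ (fun z : ℝ × ℝ => f (z.1, z.2, t + 1 / 2)) z -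
        fderiv ℝ (fun z : ℝ × ℝ => f (z.1, z.2, t)) z := fderiv_fun_sub hd1 hd2
    rw [this]
    calc _ ≤ (‖fderiv ℝ (fun z : ℝ × ℝ => f (z.1, z.2, t + 1 / 2)) z‖ₑ +
          ‖fderiv ℝ (fun z : ℝ × ℝ => f (z.1, z.2, t)) z‖ₑ) ^ 2 := by
          gcongr
          exact enorm_sub_le
      _ ≤ 4 * (8 * K * (1 + D (z.1, z.2, t + 1 / 2)) + 8 * K * (1 + D (z.1, z.2, t))) := by
          refine (ENNReal.add_sq_le_four_mul _ _).trans ?_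
          gcongr
          · exact hsq _ htI' z hz
          · exact hsq _ htI z hz
      _ = _ := by ring
  have hQint : ∫⁻ z in ω, 32 * K * (2 + (D (z.1, z.2, t + 1 / 2) + D (z.1, z.2, t))) ≤
      32 * K * (2 * volume ω + 2 * K) := by
    rw [lintegral_const_mul' _ _ (by finiteness), lintegral_add_left measurable_const,
      lintegral_const, Measure.restrict_apply_univ]
    gcongr
    exact hslice.trans (by gcongr)
  have hgood : ∀ z ∈ ω, z ∉ Bad →
      (∀ s ∈ II, 1 / 2 < β (z.1, z.2, s)) ∨ (∀ s ∈ II, β (z.1, z.2, s) < -(1 / 2)) := by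
    intro z hz hzB
    refine slice_dichotomy (β := fun s => β (z.1, z.2, s)) (D := fun s => D (z.1, z.2, s))
      (κ := K * η ^ 2) (hβ.comp (by fun_prop) fun s hs => ⟨hz, hs⟩) (fun s hs hβs => ?_)
      (not_le.1 fun hcon => hzB ⟨hz, hcon⟩)
    have := h3 (z.1, z.2, s) ⟨hz, hs⟩ hβs
    rwa [(hasDerivAt_vertical_slice hωo hβ hz hs).deriv]
  have hmean : ∀ z ∈ ω, ∃ s ∈ II, G z = β (z.1, z.2, s) / 2 := by
    intro z hz
    have hder : ∀ s ∈ II, HasDerivAt (fun s => f (z.1, z.2, s)) (β (z.1, z.2, s)) s := by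
      intro s hs
      rw [← hfβ (z.1, z.2, s) ⟨hz, hs⟩]
      exact hasDerivAt_vertical_slice hωo hf hz hs
    have hsub : Icc t (t + 1 / 2) ⊆ II := ordConnected_Ioo.out htI htI'
    obtain ⟨s, hs, hs'⟩ := exists_hasDerivAt_eq_slope (fun s => f (z.1, z.2, s))
      (fun s => β (z.1, z.2, s)) (by linarith : t < t + 1 / 2)
      (fun s hs => (hder s (hsub hs)).continuousAt.continuousWithinAt)
      (fun s hs => hder s (hsub (Ioo_subset_Icc_self hs)))
    refine ⟨s, hsub (Ioo_subset_Icc_self hs), ?_⟩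
    rw [hs', hGdef]
    ring
  have hPN : ∀ z ∈ ω, z ∉ Bad →
      ((∀ s ∈ II, 0 < β (z.1, z.2, s)) ∧ z ∈ P) ∨ ((∀ s ∈ II, β (z.1, z.2, s) < 0) ∧ z ∈ N) := by
    intro z hz hzB
    obtain ⟨s, hs, hsG⟩ := hmean z hz
    rcases hgood z hz hzB with h | h
    · exact Or.inl ⟨fun r hr => by linarith [h r hr], hz, by rw [hsG]; linarith [h s hs]⟩
    · exact Or.inr ⟨fun r hr => by linarith [h r hr], hz, by rw [hsG]; linarith [h s hs]⟩
  have hRBad : R ⊆ Bad := by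
    intro z hz
    by_contra hzB
    obtain ⟨hR1, hR2⟩ := abs_lt.1 hz.2
    rcases hPN z hz.1 hzB with h | h
    · linarith [h.2.2]
    · linarith [h.2.2]
  have hBad : volume Bad ≤ b * η ^ 2 := by
    have hm : Measurable fun z : ℝ × ℝ => ∫⁻ s in II, K * η ^ 2 * D (z.1, z.2, s) :=
      Measurable.lintegral_prod_right'
        (f := fun q : (ℝ × ℝ) × ℝ => K * η ^ 2 * D (q.1.1, q.1.2, q.2)) (by fun_prop)
    have hBad' : volume Bad = (volume.restrict ω)
        {z | c ≤ ∫⁻ s in II, K * η ^ 2 * D (z.1, z.2, s)} := by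
      rw [Measure.restrict_apply' hωo.measurableSet, inter_comm]
      rfl
    rw [hBad']
    refine (meas_ge_le_lintegral_div hm.aemeasurable hc0 hct).trans ?_
    rw [← lintegral_Om (D := fun x => K * η ^ 2 * D x) hωo (by fun_prop),
      lintegral_const_mul' _ _ (by finiteness)]
    calc K * η ^ 2 * (∫⁻ x in Om ω, D x) / c ≤ K * η ^ 2 * K / c := by gcongr
      _ = b * η ^ 2 := by simp only [b, div_eq_mul_inv]; ring
  have hPNvol : volume N * volume P ≤ C₁ * η := by
    have hmain := measure_superlevel_mul_sublevel_le volume hωo hωc (d := d)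
      (fun x hx y hy => by rw [← dist_eq_norm]; exact hd hy hx) hG hQ hη0 hηt
    have hinv : η⁻¹ * volume R ≤ b * η := by
      calc η⁻¹ * volume R ≤ η⁻¹ * (b * η ^ 2) := by
            gcongr
            exact (measure_mono hRBad).trans hBad
        _ = η⁻¹ * η * (b * η) := by ring
        _ = b * η := by rw [ENNReal.inv_mul_cancel hη0 hηt, one_mul]
    have hle : c * (volume N * volume P) ≤ c * (C₁ * η) := by
      rw [mul_comm (volume N)]
      refine hmain.trans ?_
      calc _ ≤ ENNReal.ofReal d * (2 * 2 ^ Module.finrank ℝ (ℝ × ℝ)) * volume ω *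
            (3 * (η * (32 * K * (2 * volume ω + 2 * K)) + b * η)) := by gcongr
        _ = ENNReal.ofReal d * (2 * 2 ^ Module.finrank ℝ (ℝ × ℝ)) * volume ω *
            (3 * (32 * K * (2 * volume ω + 2 * K) + b)) * η := by ring
        _ = c * (C₁ * η) := by
            rw [← hcC, mul_assoc]
    exact (ENNReal.mul_le_mul_iff_right hc0 hct).1 hle
  have hneg : volume {x ∈ Om ω | β x < 0} ≤ volume N + volume Bad := by
    refine (volume_le_of_forall_mem_Om (S := N ∪ Bad) (fun x hx => hx.1) fun x hx => ?_).trans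
      (measure_union_le _ _)
    by_cases hB : (x.1, x.2.1) ∈ Bad
    · exact Or.inr hB
    · rcases hPN _ hx.1.1 hB with h | h
      · exact absurd hx.2 (h.1 x.2.2 hx.1.2).not_gt
      · exact Or.inl h.2
  have hpos : volume {x ∈ Om ω | 0 < β x} ≤ volume P + volume Bad := by
    refine (volume_le_of_forall_mem_Om (S := P ∪ Bad) (fun x hx => hx.1) fun x hx => ?_).trans
      (measure_union_le _ _)
    by_cases hB : (x.1, x.2.1) ∈ Bad
    · exact Or.inr hB
    · rcases hPN _ hx.1.1 hB with h | h
      · exact Or.inl h.2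
      · exact absurd hx.2 (h.1 x.2.2 hx.1.2).not_gt
  have hPω : volume P ≤ volume ω := measure_mono fun z hz => hz.1
  have hNω : volume N ≤ volume ω := measure_mono fun z hz => hz.1
  have hBω : volume Bad ≤ volume ω := measure_mono fun z hz => hz.1
  calc _ ≤ (volume N + volume Bad) * (volume P + volume Bad) := by gcongr
    _ = volume N * volume P + volume Bad * (volume N + volume P + volume Bad) := by ring
    _ ≤ C₁ * η + b * η ^ 2 * (volume ω + volume ω + volume ω) := by gcongr
    _ = C₁ * η + η * (b * (3 * volume ω) * η) := by ring
    _ ≤ C₁ * η + 1 * (b * (3 * volume ω) * η) := by gcongr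
    _ = _ := by ring

lemma mnorm_eq_norm (ξ : M33) :
    mnorm ξ = ‖WithLp.toLp 2 (fun q : Fin 3 × Fin 3 => ξ q.1 q.2)‖ := by
  rw [EuclideanSpace.norm_eq, mnorm, Fintype.sum_prod_type]
  simp

lemma vnorm_eq_norm (v : V3) : vnorm v = ‖WithLp.toLp 2 v‖ := by
  rw [EuclideanSpace.norm_eq, vnorm]
  simp

lemma mnorm_nonneg (ξ : M33) : 0 ≤ mnorm ξ := Real.sqrt_nonneg _

lemma vnorm_nonneg (v : V3) : 0 ≤ vnorm v := Real.sqrt_nonneg _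

lemma mnorm_add_le (ξ ζ : M33) : mnorm (ξ + ζ) ≤ mnorm ξ + mnorm ζ := by
  simp only [mnorm_eq_norm]
  exact norm_add_le (WithLp.toLp 2 fun q : Fin 3 × Fin 3 => ξ q.1 q.2)
    (WithLp.toLp 2 fun q : Fin 3 × Fin 3 => ζ q.1 q.2)

lemma mnorm_neg (ξ : M33) : mnorm (-ξ) = mnorm ξ := by
  simp [mnorm]

lemma mnorm_sub_le (ξ ζ : M33) : mnorm (ξ - ζ) ≤ mnorm ξ + mnorm ζ := by
  simpa [sub_eq_add_neg, mnorm_neg] using mnorm_add_le ξ (-ζ)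

lemma continuous_mnorm : Continuous mnorm := by
  unfold mnorm; fun_prop

lemma continuous_vnorm : Continuous vnorm := by
  unfold vnorm; fun_prop

lemma vnorm_le_mnorm (ξ : M33) (j : Fin 3) : vnorm (ξ j) ≤ mnorm ξ :=
  Real.sqrt_le_sqrt (Finset.single_le_sum (f := fun j => ∑ i, (ξ j i) ^ 2)
    (fun _ _ => Finset.sum_nonneg fun _ _ => sq_nonneg _) (Finset.mem_univ j))

lemma norm_le_mnorm (ξ : M33) : ‖ξ‖ ≤ mnorm ξ := by
  refine (pi_norm_le_iff_of_nonneg (mnorm_nonneg ξ)).2 fun j => ?_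
  refine ((pi_norm_le_iff_of_nonneg (vnorm_nonneg _)).2 fun i => ?_).trans (vnorm_le_mnorm ξ j)
  rw [Real.norm_eq_abs]
  exact Real.abs_le_sqrt (Finset.single_le_sum (f := fun i => (ξ j i) ^ 2)
    (fun _ _ => sq_nonneg _) (Finset.mem_univ i))

lemma mdist_nonneg (A B ξ : M33) : 0 ≤ mdist A B ξ := le_min (mnorm_nonneg _) (mnorm_nonneg _)

lemma continuous_mdist (A B : M33) : Continuous (mdist A B) :=
  (continuous_mnorm.comp (by fun_prop)).min (continuous_mnorm.comp (by fun_prop))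

/-- The local nondegeneracy and the growth from below combine into a global lower bound. -/
lemma exists_mul_mdist_rpow_le {W : M33 → ℝ} {A B : M33} {p : ℝ} (hp : 0 < p)
    (hWc : Continuous W) (h1 : H1 W A B) (h2 : H2 W p) (h3 : H3 W A B p) :
    ∃ c > 0, ∀ ξ, c * mdist A B ξ ^ p ≤ W ξ := by
  obtain ⟨ϱ, hϱ, C₃, hC₃, h3⟩ := h3
  obtain ⟨C, hC, h2⟩ := h2
  obtain ⟨hW0, hWz, -, -⟩ := h1
  set r : ℝ := max (mnorm A) ((2 * C ^ 2) ^ p⁻¹) with hr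
  set S : Set M33 := {ξ | ϱ ≤ mdist A B ξ ∧ mnorm ξ ≤ r} with hSdef
  have hScl : IsClosed S :=
    (isClosed_le continuous_const (continuous_mdist A B)).inter
      (isClosed_le continuous_mnorm continuous_const)
  have hScp : IsCompact S := by
    refine (isCompact_closedBall (0 : M33) r).of_isClosed_subset hScl fun ξ hξ => ?_
    rw [mem_closedBall_zero_iff]
    exact (norm_le_mnorm ξ).trans hξ.2
  have hSpos : ∀ ξ ∈ S, 0 < W ξ := by
    intro ξ hξ
    refine lt_of_le_of_ne (hW0 ξ) fun hz => ?_
    have hm : mdist A B ξ ≤ 0 := by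
      rcases (hWz ξ).1 hz.symm with h | h
      · exact (min_le_left _ _).trans (by simp [h, mnorm])
      · exact (min_le_right _ _).trans (by simp [h, mnorm])
    linarith [hξ.1]
  have hmr : ∀ ξ, mdist A B ξ ≤ mnorm ξ + mnorm A := fun ξ =>
    (min_le_left _ _).trans (mnorm_sub_le _ _)
  obtain ⟨m, hm, hmS⟩ : ∃ m > 0, ∀ ξ ∈ S, m ≤ W ξ := by
    rcases S.eq_empty_or_nonempty with h | h
    · exact ⟨1, one_pos, by simp [h]⟩
    · obtain ⟨ζ, hζ, hmin⟩ := hScp.exists_isMinOn h hWc.continuousOn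
      exact ⟨W ζ, hSpos ζ hζ, fun ξ hξ => hmin hξ⟩
  have hr0 : 0 < r := lt_max_of_lt_right (Real.rpow_pos_of_pos (by positivity) _)
  have hrp : 0 < (2 * r) ^ p := Real.rpow_pos_of_pos (by positivity) _
  have h2p : 0 < (2 : ℝ) ^ p := Real.rpow_pos_of_pos two_pos _
  refine ⟨min C₃⁻¹ (min (m / (2 * r) ^ p) ((2 * C)⁻¹ / 2 ^ p)), by positivity, fun ξ => ?_⟩
  have hd0 : 0 ≤ mdist A B ξ ^ p := Real.rpow_nonneg (mdist_nonneg _ _ _) _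
  by_cases hξ1 : mdist A B ξ ≤ ϱ
  · exact le_trans (by gcongr; exact min_le_left _ _) (h3 ξ hξ1).1
  by_cases hξ2 : mnorm ξ ≤ r
  · have hle : mdist A B ξ ^ p ≤ (2 * r) ^ p :=
      Real.rpow_le_rpow (mdist_nonneg _ _ _)
        (by linarith [hmr ξ, le_max_left (mnorm A) ((2 * C ^ 2) ^ p⁻¹)]) hp.le
    calc _ ≤ m / (2 * r) ^ p * (2 * r) ^ p := by
          gcongr
          exact (min_le_right _ _).trans (min_le_left _ _)
      _ = m := div_mul_cancel₀ _ hrp.ne'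
      _ ≤ W ξ := hmS ξ ⟨(not_le.1 hξ1).le, hξ2⟩
  · have hξr : r < mnorm ξ := not_le.1 hξ2
    have hle : mdist A B ξ ^ p ≤ 2 ^ p * mnorm ξ ^ p := by
      rw [← Real.mul_rpow zero_le_two (mnorm_nonneg _)]
      exact Real.rpow_le_rpow (mdist_nonneg _ _ _)
        (by linarith [hmr ξ, le_max_left (mnorm A) ((2 * C ^ 2) ^ p⁻¹)]) hp.le
    have hbig : 2 * C ^ 2 ≤ mnorm ξ ^ p := by
      have := Real.rpow_le_rpow (by positivity)
        ((le_max_right (mnorm A) ((2 * C ^ 2) ^ p⁻¹)).trans hξr.le) hp.le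
      rwa [Real.rpow_inv_rpow (by positivity) hp.ne'] at this
    calc _ ≤ (2 * C)⁻¹ / 2 ^ p * (2 ^ p * mnorm ξ ^ p) := by
          gcongr
          exact (min_le_right _ _).trans (min_le_right _ _)
      _ = (2 * C)⁻¹ * mnorm ξ ^ p := by field_simp
      _ ≤ C⁻¹ * mnorm ξ ^ p - C := by
          have : C⁻¹ * mnorm ξ ^ p - C - (2 * C)⁻¹ * mnorm ξ ^ p
              = (2 * C)⁻¹ * (mnorm ξ ^ p - 2 * C ^ 2) := by field_simp; ring
          have h0 : 0 ≤ (2 * C)⁻¹ * (mnorm ξ ^ p - 2 * C ^ 2) :=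
            mul_nonneg (by positivity) (by linarith)
          linarith
      _ ≤ W ξ := (h2 ξ).1

lemma sq_le_one_add_rpow {x p : ℝ} (hx : 0 ≤ x) (hp : 2 ≤ p) : x ^ 2 ≤ 1 + x ^ p := by
  rcases le_total x 1 with h | h
  · nlinarith [Real.rpow_nonneg hx p]
  · rw [← Real.rpow_two]
    linarith [Real.rpow_le_rpow_of_exponent_le h hp]

lemma add_rpow_le_two_rpow_mul {a b p : ℝ} (ha : 0 ≤ a) (hb : 0 ≤ b) (hp : 0 ≤ p) :
    (a + b) ^ p ≤ 2 ^ p * (a ^ p + b ^ p) := by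
  have h2 := Real.rpow_pos_of_pos (two_pos (α := ℝ)) p
  rcases le_total a b with h | h
  · calc (a + b) ^ p ≤ (2 * b) ^ p := Real.rpow_le_rpow (by positivity) (by linarith) hp
      _ = 2 ^ p * b ^ p := Real.mul_rpow zero_le_two hb
      _ ≤ _ := by gcongr; linarith [Real.rpow_nonneg ha p]
  · calc (a + b) ^ p ≤ (2 * a) ^ p := Real.rpow_le_rpow (by positivity) (by linarith) hp
      _ = 2 ^ p * a ^ p := Real.mul_rpow zero_le_two ha
      _ ≤ _ := by gcongr; linarith [Real.rpow_nonneg hb p]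

lemma div_sq_le_one_add_energy {p c M h ε v w : ℝ} (hp : 2 ≤ p) (hc : 0 < c) (hh : 0 < h)
    (hε : 0 < ε) (hM : ε ≤ M * h ^ p) (hv : 0 ≤ v) (hw : c * v ^ p ≤ w) :
    (v / h) ^ 2 ≤ 1 + M / c * (ε⁻¹ * w) := by
  refine (sq_le_one_add_rpow (by positivity) hp).trans (add_le_add le_rfl ?_)
  have hhp : 0 < h ^ p := Real.rpow_pos_of_pos hh p
  have hvp : 0 ≤ v ^ p := Real.rpow_nonneg hv p
  have hw0 : 0 ≤ w := le_trans (by positivity) hw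
  rw [Real.div_rpow hv hh.le, div_le_iff₀ hhp]
  have h1 : M / c * (ε⁻¹ * w) * h ^ p = (M * h ^ p) * (w / (c * ε)) := by field_simp
  have h2 : ε * (w / (c * ε)) = w / c := by field_simp
  rw [h1]
  calc v ^ p ≤ w / c := by rw [le_div_iff₀ hc]; linarith
    _ = ε * (w / (c * ε)) := h2.symm
    _ ≤ _ := by gcongr

lemma slope_derivative_le_energy {w w₀ κ h ε y H : ℝ} (hw₀ : 0 < w₀) (hκ : 0 < κ) (hh : 0 < h)
    (hε : 0 < ε) (hw : w₀ ≤ w) (hy : 0 ≤ y) (hH : κ ^ 2 * y ^ 2 / h ^ 2 ≤ H) :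
    y ≤ (1 / w₀ + 1 / κ ^ 2) * h * (ε⁻¹ * w + ε * H) := by
  have hH0 : 0 ≤ H := le_trans (by positivity) hH
  have hw1 : 0 < w := hw₀.trans_le hw
  have hexp : (1 / w₀ + 1 / κ ^ 2) * h * (ε⁻¹ * w + ε * H) =
      h / ε * (w / w₀) + h * ε * H / w₀ + h / ε * w / κ ^ 2 + h * ε * (H / κ ^ 2) := by
    field_simp
    ring
  have t2 : 0 ≤ h * ε * H / w₀ := by positivity
  have t3 : 0 ≤ h / ε * w / κ ^ 2 := by positivity
  have t4 : 0 ≤ h * ε * (H / κ ^ 2) := by positivity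
  have t1 : h / ε ≤ h / ε * (w / w₀) :=
    le_mul_of_one_le_right (by positivity) ((one_le_div hw₀).2 hw)
  rw [hexp]
  rcases le_total (y * ε) h with hc | hc
  · have : y ≤ h / ε := (le_div_iff₀ hε).2 hc
    linarith
  · have h5 : y ^ 2 / h ^ 2 ≤ H / κ ^ 2 := by
      rw [le_div_iff₀ (by positivity)]
      calc y ^ 2 / h ^ 2 * κ ^ 2 = κ ^ 2 * y ^ 2 / h ^ 2 := by ring
        _ ≤ H := hH
    have h6 : y ≤ h * ε * (y ^ 2 / h ^ 2) := by
      have : h * ε * (y ^ 2 / h ^ 2) = y * (y * ε) / h := by field_simp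
      rw [this, le_div_iff₀ hh]
      gcongr
    have h7 : h * ε * (y ^ 2 / h ^ 2) ≤ h * ε * (H / κ ^ 2) := by gcongr
    have h8 : 0 ≤ h / ε * (w / w₀) := by positivity
    linarith

lemma exists_subseq_tendsto_zero_of_mul {a b : ℕ → ℝ≥0∞}
    (h : Tendsto (fun n => a n * b n) atTop (𝓝 0)) :
    ∃ φ : ℕ → ℕ, StrictMono φ ∧
      (Tendsto (a ∘ φ) atTop (𝓝 0) ∨ Tendsto (b ∘ φ) atTop (𝓝 0)) := by
  by_cases hcl : MapClusterPt 0 atTop a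
  · obtain ⟨φ, hφ, hlim⟩ := MapClusterPt.tendsto_subseq hcl
    exact ⟨φ, hφ, Or.inl hlim⟩
  · refine ⟨id, strictMono_id, Or.inr ?_⟩
    obtain ⟨δ, hδ0, hδt, hδ⟩ : ∃ δ : ℝ≥0∞, δ ≠ 0 ∧ δ ≠ ⊤ ∧ ∀ᶠ n in atTop, δ ≤ a n := by
      simp only [mapClusterPt_iff_frequently, not_forall, not_frequently] at hcl
      obtain ⟨s, hs, hev⟩ := hcl
      obtain ⟨δ, hδ, hsub⟩ := ENNReal.nhds_zero_basis.mem_iff.1 hs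
      refine ⟨min δ 1, (lt_min hδ one_pos).ne', by simp, ?_⟩
      filter_upwards [hev] with n hn
      exact (min_le_left _ _).trans (not_lt.1 fun hlt => hn (hsub hlt))
    have hlim : Tendsto (fun n => δ⁻¹ * (a n * b n)) atTop (𝓝 0) := by
      simpa using ENNReal.Tendsto.const_mul h (Or.inr (ENNReal.inv_ne_top.2 hδ0))
    refine tendsto_of_tendsto_of_tendsto_of_le_of_le' tendsto_const_nhds hlim
      (Eventually.of_forall fun n => zero_le) ?_
    filter_upwards [hδ] with n hn
    calc b n = δ⁻¹ * δ * b n := by rw [ENNReal.inv_mul_cancel hδ0 hδt, one_mul]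
      _ ≤ δ⁻¹ * a n * b n := by gcongr
      _ = δ⁻¹ * (a n * b n) := mul_assoc _ _ _

lemma exists_coordinate_along {a : V3} (ha : a ≠ 0) :
    ∃ L : V3 →L[ℝ] ℝ, 0 < vnorm a ∧ L a = 1 ∧ (∀ v, vnorm a * |L v| ≤ vnorm v) ∧
      ∀ v, vnorm a ^ 2 * L v = ∑ i, a i * v i := by
  have hs : vnorm a ^ 2 = ∑ i, a i ^ 2 := Real.sq_sqrt (Finset.sum_nonneg fun _ _ => sq_nonneg _)
  have hpos : 0 < vnorm a := by
    rw [vnorm_eq_norm, norm_pos_iff]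
    exact fun h => ha (by simpa using h)
  have hform : ∀ v, vnorm a ^ 2 *
      ((vnorm a ^ 2)⁻¹ • ∑ i, a i • ContinuousLinearMap.proj (R := ℝ) (φ := fun _ => ℝ) i) v =
      ∑ i, a i * v i := by
    intro v
    simp only [_root_.smul_apply, _root_.sum_apply,
      ContinuousLinearMap.proj_apply, smul_eq_mul]
    rw [mul_inv_cancel_left₀ (by positivity)]
  refine ⟨_, hpos, ?_, fun v => ?_, hform⟩
  · refine mul_left_cancel₀ (pow_ne_zero 2 hpos.ne') ?_
    rw [hform, hs, mul_one]
    exact Finset.sum_congr rfl fun i _ => (sq (a i)).symm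
  · have hcs : |∑ i, a i * v i| ≤ vnorm a * vnorm v := by
      rw [vnorm, vnorm, ← Real.sqrt_mul (Finset.sum_nonneg fun _ _ => sq_nonneg _)]
      exact Real.abs_le_sqrt (Finset.sum_mul_sq_le_sq_mul_sq _ _ _)
    rw [← hform v, abs_mul, abs_of_nonneg (sq_nonneg _),
      show ∀ t, vnorm a ^ 2 * t = vnorm a * (vnorm a * t) from fun t => by ring] at hcs
    exact le_of_mul_le_mul_left hcs hpos

lemma vnorm_le_mdist {A ξ : M33} {j : Fin 3} (hA : A j = 0) :
    vnorm (ξ j) ≤ mdist A (-A) ξ := by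
  refine le_min ?_ ?_
  · simpa [hA] using vnorm_le_mnorm (ξ - A) j
  · simpa [hA] using vnorm_le_mnorm (ξ - -A) j

lemma le_mdist_of_abs_le {A ξ : M33} {L : V3 →L[ℝ] ℝ} (hL1 : L (A 2) = 1)
    (hL : ∀ v, vnorm (A 2) * |L v| ≤ vnorm v) (hξ : |L (ξ 2)| ≤ 3 / 4) :
    vnorm (A 2) / 4 ≤ mdist A (-A) ξ := by
  obtain ⟨h1, h2⟩ := abs_le.1 hξ
  have hκ := vnorm_nonneg (A 2)
  refine le_min ?_ ?_
  · refine le_trans ?_ ((hL _).trans (vnorm_le_mnorm (ξ - A) 2))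
    have : 1 / 4 ≤ |L ((ξ - A) 2)| := by
      rw [Pi.sub_apply, map_sub, hL1, abs_sub_comm]
      exact le_trans (by linarith) (le_abs_self _)
    nlinarith
  · refine le_trans ?_ ((hL _).trans (vnorm_le_mnorm (ξ - -A) 2))
    have : 1 / 4 ≤ |L ((ξ - -A) 2)| := by
      rw [sub_neg_eq_add, Pi.add_apply, map_add, hL1]
      exact le_trans (by linarith) (le_abs_self _)
    nlinarith

lemma mnorm_sub_le_mnorm_add {A ξ : M33} (hA0 : A 0 = 0) (hA1 : A 1 = 0)
    (h : 0 ≤ ∑ i, A 2 i * ξ 2 i) : mnorm (ξ - A) ≤ mnorm (ξ + A) := by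
  refine Real.sqrt_le_sqrt ?_
  simp only [Fin.sum_univ_three, Pi.sub_apply, Pi.add_apply, hA0, hA1, Pi.zero_apply] at h ⊢
  linarith

lemma fderiv_const_mul_comp {v : Pt → V3} {x : Pt} (hv : DifferentiableAt ℝ v x)
    (L : V3 →L[ℝ] ℝ) (k : ℝ) (e : Pt) :
    fderiv ℝ (fun y => k * L (v y)) x e = k * L (pd e v x) := by
  have h : HasFDerivAt (fun y => k * L (v y)) (k • L.comp (fderiv ℝ v x)) x :=
    (L.hasFDerivAt.comp x hv.hasFDerivAt).const_mul k
  rw [h.fderiv]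
  rfl

lemma contDiffOn_pd {v : Pt → V3} {U : Set Pt} (hU : IsOpen U) (hv : ContDiffOn ℝ 2 v U)
    (e : Pt) : ContDiffOn ℝ 1 (pd e v) U :=
  (hv.fderiv_of_isOpen hU (by norm_num)).clm_apply contDiffOn_const

lemma continuousOn_pd {v : Pt → V3} {U : Set Pt} (hU : IsOpen U) (hv : ContDiffOn ℝ 1 v U)
    (e : Pt) : ContinuousOn (pd e v) U :=
  (hv.continuousOn_fderiv_of_isOpen hU le_rfl).clm_apply continuousOn_const

lemma continuousOn_gradh {v : Pt → V3} {U : Set Pt} (hU : IsOpen U) (hv : ContDiffOn ℝ 2 v U)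
    (h : ℝ) : ContinuousOn (gradh h v) U := by
  have hc := fun e => (contDiffOn_pd hU hv e).continuousOn
  refine continuousOn_pi.2 fun j => ?_
  fin_cases j
  · exact hc e1
  · exact hc e2
  · exact (hc e3).const_smul h⁻¹

lemma continuousOn_hessh {v : Pt → V3} {U : Set Pt} (hU : IsOpen U) (hv : ContDiffOn ℝ 2 v U)
    (h : ℝ) : ContinuousOn (hessh h v) U := by
  have hc : ∀ e e', ContinuousOn (fun x => vnorm (pd e (pd e' v) x)) U := fun e e' =>
    continuous_vnorm.comp_continuousOn (continuousOn_pd hU (contDiffOn_pd hU hv e') e)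
  unfold hessh
  exact (((((hc _ _).pow 2).add ((hc _ _).pow 2)).add (continuousOn_const.mul ((hc _ _).pow 2))).add
    (continuousOn_const.mul ((hc _ _).pow 2))).add (continuousOn_const.mul ((hc _ _).pow 2)) |>.add
    (continuousOn_const.mul ((hc _ _).pow 2))

lemma hessh_nonneg (h : ℝ) (v : Pt → V3) (x : Pt) : 0 ≤ hessh h v x := by
  unfold hessh; positivity

lemma vertical_le_hessh (h : ℝ) (v : Pt → V3) (x : Pt) :
    (h⁻¹) ^ 4 * vnorm (pd e3 (pd e3 v) x) ^ 2 ≤ hessh h v x := by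
  have h1 : 0 ≤ vnorm (pd e1 (pd e1 v) x) ^ 2 + vnorm (pd e2 (pd e2 v) x) ^ 2
    + 2 * vnorm (pd e2 (pd e1 v) x) ^ 2 + 2 * (h⁻¹) ^ 2 * vnorm (pd e3 (pd e1 v) x) ^ 2
    + 2 * (h⁻¹) ^ 2 * vnorm (pd e3 (pd e2 v) x) ^ 2 := by positivity
  unfold hessh
  linarith

lemma enorm_sq_le_mul_one_add {k y e : ℝ} {K : ℝ≥0∞} (hk : 0 ≤ k) (he : 0 ≤ e)
    (hK : ENNReal.ofReal k ≤ K) (h : y ^ 2 ≤ k * (1 + e)) :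
    ‖y‖ₑ ^ 2 ≤ K * (1 + ENNReal.ofReal e) := by
  calc ‖y‖ₑ ^ 2 = ENNReal.ofReal (y ^ 2) := by
        rw [← ofReal_norm, ← ENNReal.ofReal_pow (norm_nonneg _), Real.norm_eq_abs, sq_abs]
    _ ≤ ENNReal.ofReal (k * (1 + e)) := ENNReal.ofReal_le_ofReal h
    _ = ENNReal.ofReal k * (1 + ENNReal.ofReal e) := by
        rw [ENNReal.ofReal_mul hk, ENNReal.ofReal_add zero_le_one he, ENNReal.ofReal_one]
    _ ≤ _ := by gcongr

lemma enorm_le_mul_sqrt_sq_mul {k y h e : ℝ} {K : ℝ≥0∞} (hk : 0 ≤ k) (hh : 0 ≤ h)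
    (hK : ENNReal.ofReal k ≤ K) (hy : |y| ≤ k * h * e) :
    ‖y‖ₑ ≤ K * ENNReal.ofReal √h ^ 2 * ENNReal.ofReal e := by
  calc ‖y‖ₑ = ENNReal.ofReal |y| := by rw [← ofReal_norm, Real.norm_eq_abs]
    _ ≤ ENNReal.ofReal (k * h * e) := ENNReal.ofReal_le_ofReal hy
    _ = ENNReal.ofReal k * ENNReal.ofReal √h ^ 2 * ENNReal.ofReal e := by
        rw [ENNReal.ofReal_mul (by positivity), ENNReal.ofReal_mul hk,
          ← ENNReal.ofReal_pow (Real.sqrt_nonneg _), Real.sq_sqrt hh]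
    _ ≤ _ := by gcongr

/-- A single bound on the energy controls the product of the measures of the two phases. -/
lemma exists_measure_phases_mul_le {p : ℝ} (hp : 2 ≤ p) {A : M33} {W : M33 → ℝ}
    (hA0 : A 0 = 0) (hA1 : A 1 = 0) (hWc : Continuous W)
    {c : ℝ} (hc : 0 < c) (hcW : ∀ ξ, c * mdist A (-A) ξ ^ p ≤ W ξ)
    {L : V3 →L[ℝ] ℝ} (hκ : 0 < vnorm (A 2)) (hL1 : L (A 2) = 1)
    (hL : ∀ v, vnorm (A 2) * |L v| ≤ vnorm v)
    {ω : Set (ℝ × ℝ)} (hωo : IsOpen ω) (hωc : Convex ℝ ω) (hωb : Bornology.IsBounded ω)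
    {M : ℝ} (hM : 0 ≤ M) {E : ℝ≥0∞} (hE : E ≠ ⊤) :
    ∃ C : ℝ≥0∞, C ≠ ⊤ ∧ ∀ (h ε : ℝ) (u : Pt → V3), 0 < h → h ≤ 1 → 0 < ε → ε ≤ M * h ^ p →
      ContDiffOn ℝ 2 u (Om ω) → F W h ε u (Om ω) ≤ E →
      volume {x ∈ Om ω | L (gradh h u x 2) < 0} * volume {x ∈ Om ω | 0 < L (gradh h u x 2)} ≤
        C * ENNReal.ofReal √h := by
  set κ := vnorm (A 2)
  set w₀ := c * (κ / 4) ^ p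
  have hw₀ : 0 < w₀ := mul_pos hc (Real.rpow_pos_of_pos (by positivity) _)
  set k₁ := (1 + M / c) / κ ^ 2
  set k₂ := M / w₀
  set k₃ := 1 / w₀ + 1 / κ ^ 2
  have hk₁ : 0 ≤ k₁ := by positivity
  have hk₂ : 0 ≤ k₂ := by positivity
  have hk₃ : 0 ≤ k₃ := by positivity
  set K := ENNReal.ofReal (k₁ + k₂ + k₃) + E
  have hKk : ∀ k, k ≤ k₁ + k₂ + k₃ → ENNReal.ofReal k ≤ K := fun k hk =>
    (ENNReal.ofReal_le_ofReal hk).trans le_self_add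
  obtain ⟨C, hC, hmain⟩ := exists_measure_neg_mul_pos_le hωo hωc hωb (K := K) (by finiteness)
  refine ⟨C, hC, fun h ε u hh hh1 hε hεM hu hF => ?_⟩
  have hUo : IsOpen (Om ω) := isOpen_Om hωo
  have hW0 : ∀ ξ, 0 ≤ W ξ := fun ξ =>
    le_trans (mul_nonneg hc.le (Real.rpow_nonneg (mdist_nonneg _ _ _) _)) (hcW ξ)
  have hβ : ∀ x, L (gradh h u x 2) = h⁻¹ * L (pd e3 u x) := fun x => by simp [gradh]
  have hd : ∀ x ∈ Om ω, DifferentiableAt ℝ u x := fun x hx =>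
    (hu.differentiableOn (by simp)).differentiableAt (hUo.mem_nhds hx)
  have hu3 := contDiffOn_pd hUo hu e3
  have hd3 : ∀ x ∈ Om ω, DifferentiableAt ℝ (pd e3 u) x := fun x hx =>
    (hu3.differentiableOn (by simp)).differentiableAt (hUo.mem_nhds hx)
  set e : Pt → ℝ := fun x => ε⁻¹ * W (gradh h u x) + ε * hessh h u x
  have hWe : ∀ x, ε⁻¹ * W (gradh h u x) ≤ e x := fun x =>
    le_add_of_nonneg_right (mul_nonneg hε.le (hessh_nonneg _ _ _))
  have he0 : ∀ x, 0 ≤ e x := fun x => (mul_nonneg (by positivity) (hW0 _)).trans (hWe x)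
  have hec : ContinuousOn e (Om ω) :=
    (continuousOn_const.mul (hWc.comp_continuousOn (continuousOn_gradh hUo hu h))).add
      (continuousOn_const.mul (continuousOn_hessh hUo hu h))
  set D : Pt → ℝ≥0∞ := (Om ω).indicator fun x => ENNReal.ofReal (e x)
  have hD : ∀ x ∈ Om ω, D x = ENNReal.ofReal (e x) := fun x hx => indicator_of_mem hx _
  have hDm : Measurable D := by
    classical
    have : Measurable ((Om ω).piecewise (fun x => ENNReal.ofReal (e x)) 0) :=
      (ENNReal.continuous_ofReal.comp_continuousOn hec).measurable_piecewise
        continuousOn_const hUo.measurableSet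
    rwa [Set.piecewise_eq_indicator] at this
  have hhor : ∀ x ∈ Om ω, ∀ v : V3, vnorm v ≤ mdist A (-A) (gradh h u x) →
      ‖h⁻¹ * L v‖ₑ ^ 2 ≤ K * (1 + D x) := by
    intro x hx v hv
    rw [hD x hx]
    refine enorm_sq_le_mul_one_add hk₁ (he0 x) (hKk _ (by linarith)) ?_
    have h1 : c * vnorm v ^ p ≤ W (gradh h u x) := le_trans (by
      gcongr
      exact vnorm_nonneg v) (hcW _)
    have h2 := div_sq_le_one_add_energy hp hc hh hε hεM (vnorm_nonneg v) h1
    have h3 : (h⁻¹ * L v) ^ 2 ≤ (vnorm v / h) ^ 2 / κ ^ 2 := by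
      rw [← div_pow, ← sq_abs, abs_mul, abs_of_pos (inv_pos.2 hh)]
      refine pow_le_pow_left₀ (by positivity) ?_ 2
      rw [le_div_iff₀ hκ, div_eq_inv_mul]
      calc h⁻¹ * |L v| * κ = h⁻¹ * (κ * |L v|) := by ring
        _ ≤ _ := by gcongr; exact hL v
    calc _ ≤ (vnorm v / h) ^ 2 / κ ^ 2 := h3
      _ ≤ ((1 + M / c) * (1 + e x)) / κ ^ 2 := by
          gcongr
          have h4 : M / c * (ε⁻¹ * W (gradh h u x)) ≤ M / c * e x := by
            gcongr
            exact hWe x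
          have h5 : 0 ≤ M / c := by positivity
          nlinarith [he0 x]
      _ = _ := by simp only [k₁]; ring
  have hηsq : ε ≤ M * h := hεM.trans (by
    gcongr
    simpa using Real.rpow_le_rpow_of_exponent_ge hh hh1 (by linarith : (1 : ℝ) ≤ p))
  have := hmain (ENNReal.ofReal √h) (fun x => h⁻¹ * L (u x)) (fun x => h⁻¹ * L (pd e3 u x)) D
    (by simpa using hh) (by simpa using hh1)
    (contDiffOn_const.mul (L.contDiff.comp_contDiffOn (hu.of_le one_le_two)))
    (contDiffOn_const.mul (L.contDiff.comp_contDiffOn hu3))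
    (fun x hx => fderiv_const_mul_comp (hd x hx) L _ _) hDm
    (fun x hx => by
      rw [fderiv_const_mul_comp (hd x hx)]
      exact hhor x hx _ (vnorm_le_mdist (ξ := gradh h u x) (j := 0) hA0))
    (fun x hx => by
      rw [fderiv_const_mul_comp (hd x hx)]
      exact hhor x hx _ (vnorm_le_mdist (ξ := gradh h u x) (j := 1) hA1))
    (fun x hx hx34 => ?_) ?_
  · simpa only [hβ] using this
  · rw [← hβ] at hx34
    have hw : w₀ ≤ W (gradh h u x) :=
      (mul_le_mul_of_nonneg_left (Real.rpow_le_rpow (by positivity)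
        (le_mdist_of_abs_le hL1 hL hx34) (by linarith)) hc.le).trans (hcW _)
    rw [hD x hx, fderiv_const_mul_comp (hd3 x hx)]
    constructor
    · have := enorm_le_mul_sqrt_sq_mul (y := 1) (e := e x) hk₂ hh.le (hKk k₂ (by linarith)) ?_
      · simpa using this
      · rw [abs_one]
        calc (1 : ℝ) ≤ k₂ * h * (ε⁻¹ * w₀) := by
              have : k₂ * h * (ε⁻¹ * w₀) = M * h / ε := by
                simp only [k₂]
                field_simp
              rwa [this, one_le_div hε]
          _ ≤ k₂ * h * (ε⁻¹ * W (gradh h u x)) := by gcongr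
          _ ≤ k₂ * h * e x := mul_le_mul_of_nonneg_left (hWe x) (by positivity)
    · refine enorm_le_mul_sqrt_sq_mul hk₃ hh.le (hKk k₃ (by linarith)) ?_
      refine slope_derivative_le_energy hw₀ hκ hh hε hw (abs_nonneg _) ?_
      refine le_trans ?_ (vertical_le_hessh h u x)
      calc κ ^ 2 * |h⁻¹ * L (pd e3 (pd e3 u) x)| ^ 2 / h ^ 2
          = h⁻¹ ^ 4 * (κ * |L (pd e3 (pd e3 u) x)|) ^ 2 := by
            rw [abs_mul, abs_of_pos (inv_pos.2 hh)]
            field_simp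
        _ ≤ _ := by
            gcongr
            exact hL _
  · rw [setLIntegral_congr_fun hUo.measurableSet hD]
    exact hF.trans le_add_self

/-- Where the gradient is closest to `ξ₀` the energy controls the distance to `ξ₀`; elsewhere the
distance to `ξ₀` exceeds it by at most a constant. -/
lemma lintegral_rpow_le_energy_add_measure {p : ℝ} (hp : 0 ≤ p) {A B ξ₀ : M33} {W : M33 → ℝ}
    {c : ℝ} (hc : 0 < c) (hcW : ∀ ξ, c * mdist A B ξ ^ p ≤ W ξ) {m : ℝ} (hm : 0 ≤ m)
    (hm' : ∀ ξ, mnorm (ξ - ξ₀) ≤ mdist A B ξ + m) {U S : Set Pt} (hU : MeasurableSet U)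
    (hS : MeasurableSet S) {h ε : ℝ} (hε : 0 < ε) {u : Pt → V3}
    (hUS : ∀ x ∈ U, x ∉ S → mnorm (gradh h u x - ξ₀) = mdist A B (gradh h u x)) :
    ∫⁻ x in U, ENNReal.ofReal (mnorm (gradh h u x - ξ₀) ^ p) ≤
      ENNReal.ofReal (2 ^ p * ε / c) * F W h ε u U + ENNReal.ofReal (2 ^ p * m ^ p) * volume S := by
  have h2 : (1 : ℝ) ≤ 2 ^ p := Real.one_le_rpow one_le_two hp
  have hmp : 0 ≤ m ^ p := Real.rpow_nonneg hm p
  have hd : ∀ ξ, mdist A B ξ ^ p ≤ W ξ / c := fun ξ => by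
    rw [le_div_iff₀ hc, mul_comm]
    exact hcW ξ
  have hd0 : ∀ ξ, 0 ≤ mdist A B ξ ^ p := fun ξ => Real.rpow_nonneg (mdist_nonneg _ _ _) _
  have hen : ∀ x, 2 ^ p * mdist A B (gradh h u x) ^ p ≤
      2 ^ p * ε / c * (ε⁻¹ * W (gradh h u x) + ε * hessh h u x) := by
    intro x
    have h3 : 0 ≤ 2 ^ p * ε / c * (ε * hessh h u x) :=
      mul_nonneg (by positivity) (mul_nonneg hε.le (hessh_nonneg _ _ _))
    calc 2 ^ p * mdist A B (gradh h u x) ^ p ≤ 2 ^ p * (W (gradh h u x) / c) := by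
          gcongr
          exact hd _
      _ = 2 ^ p * ε / c * (ε⁻¹ * W (gradh h u x)) := by field_simp
      _ ≤ _ := by rw [mul_add]; linarith
  have hpt : ∀ x ∈ U, ENNReal.ofReal (mnorm (gradh h u x - ξ₀) ^ p) ≤
      ENNReal.ofReal (2 ^ p * ε / c) *
        ENNReal.ofReal (ε⁻¹ * W (gradh h u x) + ε * hessh h u x) +
      S.indicator (fun _ => ENNReal.ofReal (2 ^ p * m ^ p)) x := by
    intro x hx
    rw [← ENNReal.ofReal_mul (by positivity)]
    by_cases hxS : x ∈ S
    · rw [indicator_of_mem hxS]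
      refine le_trans (ENNReal.ofReal_le_ofReal ?_) (ENNReal.ofReal_add_le)
      calc mnorm (gradh h u x - ξ₀) ^ p ≤ (mdist A B (gradh h u x) + m) ^ p :=
            Real.rpow_le_rpow (mnorm_nonneg _) (hm' _) hp
        _ ≤ 2 ^ p * (mdist A B (gradh h u x) ^ p + m ^ p) :=
            add_rpow_le_two_rpow_mul (mdist_nonneg _ _ _) hm hp
        _ ≤ _ := by rw [mul_add]; linarith [hen x]
    · rw [indicator_of_notMem hxS, add_zero, hUS x hx hxS]
      exact ENNReal.ofReal_le_ofReal
        ((le_mul_of_one_le_left (hd0 _) h2).trans (hen x))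
  calc _ ≤ _ := setLIntegral_mono' hU hpt
    _ = _ := lintegral_add_right _ (measurable_const.indicator hS)
    _ ≤ _ := by
      refine add_le_add ?_ ?_
      · rw [lintegral_const_mul' _ _ ENNReal.ofReal_ne_top, F]
      · rw [lintegral_indicator_const hS]
        gcongr
        exact Measure.restrict_le_self

end
/-- Theorem 6.8, rigidity for wells with A' = B' = 0. -/
theorem statement18 (p : ℝ) (hp : 2 ≤ p) (A B : M33) (W : M33 → ℝ)
    (A3 : V3) (hA3 : A3 ≠ 0)
    (hWc : Continuous W) (h1 : H1 W A B) (h2 : H2 W p) (h3 : H3 W A B p)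
    (hAB : A = -B) (hA0 : A 0 = 0) (hA1 : A 1 = 0) (hA2 : A 2 = A3)
    (ω : Set (ℝ × ℝ)) (hωo : IsOpen ω) (hωc : Convex ℝ ω)
    (hωb : Bornology.IsBounded ω) (hωne : ω.Nonempty)
    (h ε : ℕ → ℝ) (hh : ∀ n, 0 < h n) (hε : ∀ n, 0 < ε n)
    (hh0 : Tendsto h atTop (nhds 0)) (hε0 : Tendsto ε atTop (nhds 0))
    (hratio : ∃ M : ℝ, ∀ n, ε n / (h n) ^ p ≤ M)
    (u : ℕ → Pt → V3) (hu : ∀ n, ContDiffOn ℝ 2 (u n) (Om ω))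
    (hbd : ∃ C : ℝ≥0∞, C < ⊤ ∧ ∀ n, F W (h n) (ε n) (u n) (Om ω) ≤ C) :
    ∃ φ : ℕ → ℕ, StrictMono φ ∧ ∃ ξ₀ : M33, (ξ₀ = A ∨ ξ₀ = B) ∧
      Tendsto (fun n => ∫⁻ x in Om ω,
        ENNReal.ofReal ((mnorm (gradh (h (φ n)) (u (φ n)) x - ξ₀)) ^ p))
        atTop (nhds 0) := by
  have hp0 : 0 < p := by linarith
  obtain ⟨c, hc, hcW⟩ := exists_mul_mdist_rpow_le hp0 hWc h1 h2 h3
  obtain ⟨M, hM⟩ := hratio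
  obtain ⟨E, hE, hF⟩ := hbd
  have hB : B = -A := by rw [hAB, neg_neg]
  subst hB
  subst hA2
  obtain ⟨L, hκ, hL1, hL, hLform⟩ := exists_coordinate_along hA3
  obtain ⟨C, hC, hmain⟩ := exists_measure_phases_mul_le hp hA0 hA1 hWc hc hcW hκ hL1 hL hωo hωc
    hωb (le_max_right M 0) hE.ne
  have hUo : IsOpen (Om ω) := isOpen_Om hωo
  set β : ℕ → Pt → ℝ := fun n x => L (gradh (h n) (u n) x 2)
  have hβc : ∀ n, ContinuousOn (β n) (Om ω) := fun n =>
    L.continuous.comp_continuousOn (continuousOn_pi.1 (continuousOn_gradh hUo (hu n) _) 2)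
  have hprod : Tendsto (fun n => volume {x ∈ Om ω | β n x < 0} * volume {x ∈ Om ω | 0 < β n x})
      atTop (𝓝 0) := by
    have hlim : Tendsto (fun n => C * ENNReal.ofReal √(h n)) atTop (𝓝 0) := by
      have hs : Tendsto (fun n => √(h n)) atTop (𝓝 0) := by
        simpa [Function.comp_def] using (Real.continuous_sqrt.tendsto 0).comp hh0
      simpa using ENNReal.Tendsto.const_mul (ENNReal.tendsto_ofReal hs) (Or.inr hC)
    refine tendsto_of_tendsto_of_tendsto_of_le_of_le' tendsto_const_nhds hlim
      (Eventually.of_forall fun _ => zero_le) ?_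
    filter_upwards [hh0.eventually_le_const one_pos] with n hn
    refine hmain _ _ _ (hh n) hn (hε n) ?_ (hu n) (hF n)
    rw [← div_le_iff₀ (Real.rpow_pos_of_pos (hh n) p)]
    exact (hM n).trans (le_max_left _ _)
  obtain ⟨φ, hφ, hAB0⟩ := exists_subseq_tendsto_zero_of_mul hprod
  set m := mnorm (A + A)
  have hmA : ∀ ξ, mnorm (ξ - A) ≤ mdist A (-A) ξ + m := fun ξ => by
    refine le_trans (le_min ?_ ?_) (min_add_add_right _ _ m).le
    · exact le_add_of_nonneg_right (mnorm_nonneg _)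
    · simpa [m, sub_eq_add_neg, add_assoc] using mnorm_sub_le (ξ - -A) (A + A)
  have hmB : ∀ ξ, mnorm (ξ - -A) ≤ mdist A (-A) ξ + m := fun ξ => by
    refine le_trans (le_min ?_ ?_) (min_add_add_right _ _ m).le
    · simpa [m, sub_eq_add_neg, add_assoc] using mnorm_add_le (ξ - A) (A + A)
    · exact le_add_of_nonneg_right (mnorm_nonneg _)
  have hconv : ∀ ξ₀, (∀ ξ, mnorm (ξ - ξ₀) ≤ mdist A (-A) ξ + m) → ∀ S : ℕ → Set Pt,
      (∀ n, MeasurableSet (S n)) → (∀ n, ∀ x ∈ Om ω, x ∉ S n →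
        mnorm (gradh (h n) (u n) x - ξ₀) = mdist A (-A) (gradh (h n) (u n) x)) →
      Tendsto (fun n => volume (S (φ n))) atTop (𝓝 0) →
      Tendsto (fun n => ∫⁻ x in Om ω,
        ENNReal.ofReal ((mnorm (gradh (h (φ n)) (u (φ n)) x - ξ₀)) ^ p)) atTop (𝓝 0) := by
    intro ξ₀ hξ₀ S hSm hS hS0
    have hlim : Tendsto (fun n => ENNReal.ofReal (2 ^ p * ε (φ n) / c) * E +
        ENNReal.ofReal (2 ^ p * m ^ p) * volume (S (φ n))) atTop (𝓝 0) := by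
      have he : Tendsto (fun n => 2 ^ p * ε (φ n) / c) atTop (𝓝 0) := by
        simpa using ((hε0.comp hφ.tendsto_atTop).const_mul (2 ^ p)).div_const c
      simpa using (ENNReal.Tendsto.mul_const (ENNReal.tendsto_ofReal he) (Or.inr hE.ne)).add
        (ENNReal.Tendsto.const_mul hS0 (Or.inr ENNReal.ofReal_ne_top))
    refine tendsto_of_tendsto_of_tendsto_of_le_of_le tendsto_const_nhds hlim
      (fun _ => zero_le) fun n => ?_
    refine (lintegral_rpow_le_energy_add_measure hp0.le hc hcW (mnorm_nonneg _) hξ₀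
      hUo.measurableSet (hSm (φ n)) (hε (φ n)) (hS (φ n))).trans ?_
    gcongr
    exact hF _
  refine ⟨φ, hφ, ?_⟩
  rcases hAB0 with hneg | hpos
  · refine ⟨A, Or.inl rfl, hconv A hmA (fun n => {x ∈ Om ω | β n x < 0})
      (fun n => ((hβc n).isOpen_inter_preimage hUo isOpen_Iio).measurableSet)
      (fun n x hx hxS => (min_eq_left ?_).symm) hneg⟩
    have hβx : 0 ≤ β n x := not_lt.1 fun hlt => hxS ⟨hx, hlt⟩
    rw [sub_neg_eq_add]
    refine mnorm_sub_le_mnorm_add hA0 hA1 ?_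
    rw [← hLform]
    positivity
  · refine ⟨-A, Or.inr rfl, hconv (-A) hmB (fun n => {x ∈ Om ω | 0 < β n x})
      (fun n => ((hβc n).isOpen_inter_preimage hUo isOpen_Ioi).measurableSet)
      (fun n x hx hxS => (min_eq_right ?_).symm) hpos⟩
    have hβx : β n x ≤ 0 := not_lt.1 fun hlt => hxS ⟨hx, hlt⟩
    have hle := mnorm_sub_le_mnorm_add (A := -A) (ξ := gradh (h n) (u n) x)
      (by simp [hA0]) (by simp [hA1]) ?_
    · rwa [← sub_eq_add_neg] at hle
    · simp only [Pi.neg_apply, neg_mul, Finset.sum_neg_distrib]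
      rw [← hLform, Left.nonneg_neg_iff]
      exact mul_nonpos_of_nonneg_of_nonpos (sq_nonneg _) hβx
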